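/- arXiv:2401.12397 — 2 statements merged into one kernel-verified Lean document; each statement's English description precedes it below -/
import Mathlib

section
/- Let G be a finite graph with a percolation measure, A a set of vertices, and 0, b vertices lying in disjoint components of G∖A, such that 0 is an isolated vertex of G∖A (every edge from 0 goes into A). Then P(0↔b) ≥ min_{a∈A} P(a↔b) − Σ_{W: W∩A=∅} P(C(0)=W) · min_{a∈A} P_{G∖W}(a↔b), where the sum is over possible clusters W of 0 disjoint from A. -/
open scoped BigOperators

structure PercGraph (V E : Type) where
  ends : E → V × V
  p : E → ℝ

namespace PercGraph

variable {V E : Type} [DecidableEq V] [Fintype E] [DecidableEq E]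

/-- Weight of a configuration: each edge `e` is open (`ω e = true`) with probability `p e`. -/
def weight (G : PercGraph V E) (ω : E → Bool) : ℝ :=
  ∏ e, if ω e then G.p e else 1 - G.p e

/-- Probability of an event under the percolation measure. -/
noncomputable def prob (G : PercGraph V E) (S : Set (E → Bool)) : ℝ :=
  ∑ ω : E → Bool, Set.indicator S G.weight ω

/-- Expectation of a function under the percolation measure. -/
noncomputable def expec (G : PercGraph V E) (f : (E → Bool) → ℝ) : ℝ :=
  ∑ ω : E → Bool, f ω * G.weight ω

/-- Two vertices are adjacent via an open edge in configuration `ω`. -/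
def adj (G : PercGraph V E) (ω : E → Bool) (x y : V) : Prop :=
  ∃ e, ω e = true ∧ (G.ends e = (x, y) ∨ G.ends e = (y, x))

/-- `x` and `y` are connected by a path of open edges. -/
def Conn (G : PercGraph V E) (ω : E → Bool) (x y : V) : Prop :=
  Relation.ReflTransGen (G.adj ω) x y

/-- The union of the open clusters of the vertices of `A`. -/
def cluster (G : PercGraph V E) (ω : E → Bool) (A : Set V) : Set V :=
  {y | ∃ a ∈ A, G.Conn ω a y}

/-- The event `x ↔ y`. -/
def connEvent (G : PercGraph V E) (x y : V) : Set (E → Bool) :=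
  {ω | G.Conn ω x y}

/-- The event `x ↔ A`. -/
def connTo (G : PercGraph V E) (x : V) (A : Set V) : Set (E → Bool) :=
  {ω | ∃ a ∈ A, G.Conn ω x a}

/-- The event `A ↮ B`. -/
def disconn (G : PercGraph V E) (A B : Set V) : Set (E → Bool) :=
  {ω | ∀ a ∈ A, ∀ b ∈ B, ¬ G.Conn ω a b}

def IncreasingEvent (S : Set (E → Bool)) : Prop :=
  ∀ ⦃ω ω' : E → Bool⦄, (∀ e, ω e = true → ω' e = true) → ω ∈ S → ω' ∈ S

def DecreasingEvent (S : Set (E → Bool)) : Prop :=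
  ∀ ⦃ω ω' : E → Bool⦄, (∀ e, ω e = true → ω' e = true) → ω' ∈ S → ω ∈ S

def IncreasingFun (f : (E → Bool) → ℝ) : Prop :=
  ∀ ⦃ω ω' : E → Bool⦄, (∀ e, ω e = true → ω' e = true) → f ω ≤ f ω'

/-- `f` is determined by the cluster of `A`. -/
def ClusterDetermined (G : PercGraph V E) (A : Set V) (f : (E → Bool) → ℝ) : Prop :=
  ∀ ω ω', G.cluster ω A = G.cluster ω' A → f ω = f ω'

/-- The event `S` is determined by the cluster of `A`. -/
def ClusterDeterminedEvent (G : PercGraph V E) (A : Set V) (S : Set (E → Bool)) : Prop :=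
  ∀ ω ω', G.cluster ω A = G.cluster ω' A → (ω ∈ S ↔ ω' ∈ S)

noncomputable def condProb (G : PercGraph V E) (S T : Set (E → Bool)) : ℝ :=
  G.prob (S ∩ T) / G.prob T

noncomputable def condExpec (G : PercGraph V E) (f : (E → Bool) → ℝ) (T : Set (E → Bool)) : ℝ :=
  G.expec (T.indicator f) / G.prob T

/-- The edge `e` is incident to the vertex `x`. -/
def incident (G : PercGraph V E) (x : V) (e : E) : Prop :=
  (G.ends e).1 = x ∨ (G.ends e).2 = x

/-- The other endpoint of an edge incident to `x`. -/
def otherEnd (G : PercGraph V E) (x : V) (e : E) : V :=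
  if (G.ends e).1 = x then (G.ends e).2 else (G.ends e).1

/-- The graph `G ∖ W`: delete the vertices of `W` and all incident edges. -/
def delete (G : PercGraph V E) (W : Finset V) :
    PercGraph V {e : E // (G.ends e).1 ∉ W ∧ (G.ends e).2 ∉ W} :=
  ⟨fun e => G.ends e.1, fun e => G.p e.1⟩

/-- The graph `G` with the probability of edge `e` replaced by `q`. -/
def withEdgeProb (G : PercGraph V E) (e : E) (q : ℝ) : PercGraph V E :=
  ⟨G.ends, Function.update G.p e q⟩

/-- Contraction of the edge `e`: set its probability to 1. -/
def contract (G : PercGraph V E) (e : E) : PercGraph V E :=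
  G.withEdgeProb e 1

/-- The event that `e` is pivotal for `U`. -/
def pivotal (e : E) (U : Set (E → Bool)) : Set (E → Bool) :=
  {ω | ¬ ((Function.update ω e true ∈ U) ↔ (Function.update ω e false ∈ U))}

/-- All edge probabilities lie in `[0,1]`. -/
def ProbValid (G : PercGraph V E) : Prop := ∀ e, 0 ≤ G.p e ∧ G.p e ≤ 1

end PercGraph

namespace PercGraph

variable {V E : Type} [Fintype V] [DecidableEq V] [Fintype E] [DecidableEq E]

/-- The quadruple `(G, A, x₀, b)` is *good*:
`P(0↔b) ≥ min_{a∈A} P(a↔b) − Σ_{W∩A=∅} P(C(0)=W)·min_{a∈A} P_{G∖W}(a↔b)`. -/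
noncomputable def Good (G : PercGraph V E) (A : Finset V) (hA : A.Nonempty)
    (x₀ b : V) : Prop :=
  A.inf' hA (fun a => G.prob (G.connEvent a b)) -
      ∑ W ∈ Finset.univ.filter (fun W : Finset V => W ∩ A = ∅),
        G.prob {ω | G.cluster ω {x₀} = ↑W} *
          A.inf' hA (fun a => (G.delete W).prob ((G.delete W).connEvent a b))
    ≤ G.prob (G.connEvent x₀ b)

end PercGraph

namespace PercGraph

section Measure

theorem weight_nonneg {V E : Type} [Fintype E] {G : PercGraph V E} (hp : G.ProbValid)
    (ω : E → Bool) : 0 ≤ G.weight ω := by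
  refine Finset.prod_nonneg fun e _ => ?_
  split_ifs
  · exact (hp e).1
  · linarith [(hp e).2]

variable {V E : Type} [Fintype E] [DecidableEq E] (G : PercGraph V E)

theorem sum_weight : ∑ ω : E → Bool, G.weight ω = 1 := by
  have h := Finset.prod_univ_sum (fun _ : E => (Finset.univ : Finset Bool))
    (fun e c => if c then G.p e else 1 - G.p e)
  simp only [Fintype.piFinset_univ] at h
  unfold weight
  rw [← h]
  simp

variable {G}

theorem prob_nonneg (hp : G.ProbValid) (S : Set (E → Bool)) : 0 ≤ G.prob S :=
  Finset.sum_nonneg fun _ _ => Set.indicator_nonneg (fun ω _ => weight_nonneg hp ω) _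

theorem prob_mono (hp : G.ProbValid) {S T : Set (E → Bool)} (h : S ⊆ T) :
    G.prob S ≤ G.prob T :=
  Finset.sum_le_sum fun _ _ =>
    Set.indicator_le_indicator_of_subset h (fun ω => weight_nonneg hp ω) _

variable (G)

theorem prob_univ : G.prob Set.univ = 1 := by
  simp [prob, sum_weight]

theorem prob_empty : G.prob ∅ = 0 := by
  simp [prob]

theorem prob_inter_add_diff (S T : Set (E → Bool)) :
    G.prob (S ∩ T) + G.prob (S \ T) = G.prob S := by
  classical
  simp only [prob, ← Finset.sum_add_distrib]
  refine Finset.sum_congr rfl fun ω _ => ?_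
  by_cases h₁ : ω ∈ S <;> by_cases h₂ : ω ∈ T <;> simp [h₁, h₂]

theorem prob_eq_expec (S : Set (E → Bool)) : G.prob S = G.expec (S.indicator 1) := by
  classical
  refine Finset.sum_congr rfl fun ω _ => ?_
  by_cases h : ω ∈ S <;> simp [h]

/-- Conditioning on the state of a single edge. -/
theorem expec_eq_update (e : E) (f : (E → Bool) → ℝ) :
    G.expec f = G.expec fun ω => G.p e * f (Function.update ω e true) +
      (1 - G.p e) * f (Function.update ω e false) := by
  have key : ∀ g : (E → Bool) → ℝ, G.expec g =
      ∑ η : {j // j ≠ e} → Bool,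
        (g ((Equiv.funSplitAt e Bool).symm (true, η)) * G.p e +
          g ((Equiv.funSplitAt e Bool).symm (false, η)) * (1 - G.p e)) *
        ∏ j : {j // j ≠ e}, if η j then G.p j else 1 - G.p j := by
    intro g
    unfold expec
    rw [← (Equiv.funSplitAt e Bool).symm.sum_comp, Fintype.sum_prod_type_right]
    refine Finset.sum_congr rfl fun η _ => ?_
    have hw : ∀ c, G.weight ((Equiv.funSplitAt e Bool).symm (c, η)) =
        (if c then G.p e else 1 - G.p e) *
          ∏ j : {j // j ≠ e}, if η j then G.p j else 1 - G.p j := by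
      intro c
      unfold weight
      rw [Fintype.prod_eq_mul_prod_subtype_ne _ e]
      congr 1
      · simp
      · refine Finset.prod_congr rfl fun j _ => ?_
        simp [j.2]
    simp only [Fintype.sum_bool, hw]
    simp
    ring
  have hu : ∀ (c d : Bool) (η : {j // j ≠ e} → Bool),
      Function.update ((Equiv.funSplitAt e Bool).symm (c, η)) e d =
        (Equiv.funSplitAt e Bool).symm (d, η) := by
    intro c d η
    ext j
    by_cases h : j = e
    · subst h; simp
    · simp [h]
  rw [key f, key]
  refine Finset.sum_congr rfl fun η _ => ?_
  simp only [hu]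
  ring

theorem prob_eq_update (e : E) (S : Set (E → Bool)) :
    G.prob S = G.p e * G.prob {ω | Function.update ω e true ∈ S} +
      (1 - G.p e) * G.prob {ω | Function.update ω e false ∈ S} := by
  classical
  rw [prob_eq_expec, expec_eq_update G e, prob_eq_expec, prob_eq_expec]
  simp only [expec, Finset.mul_sum, ← Finset.sum_add_distrib]
  refine Finset.sum_congr rfl fun ω _ => ?_
  simp only [Set.indicator_apply, Set.mem_ofPred_eq, Pi.one_apply]
  ring

/-- Resampling the edges of `F` independently does not change the percolation measure. -/
theorem expec_eq_resample (F : Finset E) (f : (E → Bool) → ℝ) :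
    G.expec f = G.expec fun ω => G.expec fun ω' => f (F.piecewise ω' ω) := by
  induction F using Finset.induction_on generalizing f with
  | empty => simp [expec, ← Finset.mul_sum, sum_weight]
  | insert e F he ih =>
    have hc : ∀ (ω ω' : E → Bool) (c : Bool),
        (insert e F).piecewise (Function.update ω' e c) ω =
          Function.update (F.piecewise ω' ω) e c := by
      intro ω ω' c
      ext j
      by_cases h : j = e
      · subst h; simp
      · by_cases hj : j ∈ F <;> simp [h, hj, Finset.piecewise]
    rw [expec_eq_update G e f, ih]
    congr 1
    ext ω
    rw [expec_eq_update G e (fun ω' => f ((insert e F).piecewise ω' ω))]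
    simp only [hc]

theorem prob_eq_resample (F : Finset E) (S : Set (E → Bool)) :
    G.prob S = G.expec fun ω => G.prob {ω' | F.piecewise ω' ω ∈ S} := by
  rw [prob_eq_expec, expec_eq_resample G F]
  simp only [prob_eq_expec]
  rfl

theorem prob_delete [DecidableEq V] (W : Finset V)
    (T : Set ({e : E // (G.ends e).1 ∉ W ∧ (G.ends e).2 ∉ W} → Bool)) :
    (G.delete W).prob T = G.prob {ω | (fun e => ω e.1) ∈ T} := by
  classical
  let q : E → Prop := fun e => (G.ends e).1 ∉ W ∧ (G.ends e).2 ∉ W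
  let H : PercGraph V {e // ¬ q e} := ⟨fun e => G.ends e.1, fun e => G.p e.1⟩
  have hw : ∀ (η : {e // q e} → Bool) (ζ : {e // ¬ q e} → Bool),
      G.weight ((Equiv.piEquivPiSubtypeProd q (fun _ => Bool)).symm (η, ζ)) =
        (G.delete W).weight η * H.weight ζ := by
    intro η ζ
    unfold weight
    rw [← Fintype.prod_subtype_mul_prod_subtype q]
    congr 1
    · refine Finset.prod_congr (by ext; simp) fun j _ => ?_
      simp [j.2, delete]
    · refine Finset.prod_congr rfl fun j _ => ?_
      simp [j.2, H]
  have hr : ∀ (η : {e // q e} → Bool) (ζ : {e // ¬ q e} → Bool),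
      (fun e : {e // q e} =>
        (Equiv.piEquivPiSubtypeProd q (fun _ => Bool)).symm (η, ζ) e.1) = η := by
    intro η ζ
    ext j
    simp [j.2]
  unfold prob
  rw [← (Equiv.piEquivPiSubtypeProd q (fun _ => Bool)).symm.sum_comp, Fintype.sum_prod_type]
  refine Finset.sum_congr rfl fun η _ => ?_
  have : ∀ ζ, Set.indicator {ω : E → Bool | (fun e : {e // q e} => ω e.1) ∈ T} G.weight
      ((Equiv.piEquivPiSubtypeProd q (fun _ => Bool)).symm (η, ζ)) =
      Set.indicator T (G.delete W).weight η * H.weight ζ := by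
    intro ζ
    simp only [Set.indicator_apply, Set.mem_ofPred_eq, hr, hw]
    split_ifs <;> simp
  exact (by rw [Finset.sum_congr rfl fun ζ _ => this ζ, ← Finset.mul_sum, sum_weight, mul_one] :
    _ = _).symm

end Measure

section Connectivity

variable {V E : Type} {G : PercGraph V E} {ω ω' : E → Bool} {x y z : V}

theorem adj_symm (h : G.adj ω x y) : G.adj ω y x := by
  obtain ⟨e, he, h⟩ := h
  exact ⟨e, he, h.symm⟩

theorem Conn.symm (h : G.Conn ω x y) : G.Conn ω y x := by
  induction h with
  | refl => exact .refl
  | tail _ hadj ih => exact .head (adj_symm hadj) ih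

theorem Conn.mono (hω : ∀ e, ω e = true → ω' e = true) (h : G.Conn ω x y) : G.Conn ω' x y := by
  induction h with
  | refl => exact .refl
  | tail _ hadj ih =>
    obtain ⟨e, he, h⟩ := hadj
    exact ih.tail ⟨e, hω e he, h⟩

theorem Conn.eq_of_isolated (hx : ∀ e, ω e = true → ¬ G.incident x e) (h : G.Conn ω x y) :
    y = x := by
  induction h with
  | refl => rfl
  | tail _ hadj ih =>
    subst ih
    obtain ⟨e, he, h | h⟩ := hadj
    · exact absurd (Or.inl (by rw [h])) (hx e he)
    · exact absurd (Or.inr (by rw [h])) (hx e he)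

theorem disconn_comm {X Y : Set V} : ω ∈ G.disconn X Y ↔ ω ∈ G.disconn Y X :=
  ⟨fun h y hy x hx hc => h x hx y hy hc.symm, fun h x hx y hy hc => h y hy x hx hc.symm⟩

theorem disconn_anti {X X' Y Y' : Set V} (hX : X ⊆ X') (hY : Y ⊆ Y') :
    G.disconn X' Y' ⊆ G.disconn X Y :=
  fun _ h x hx y hy => h x (hX hx) y (hY hy)

theorem cluster_singleton_eq_iff {x₀ : V}
    (hloop : ∀ e, G.ends e ≠ (x₀, x₀)) :
    G.cluster ω {x₀} = {x₀} ↔ ∀ t, ¬ G.adj ω x₀ t := by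
  constructor
  · rintro h t ht
    have : t ∈ G.cluster ω {x₀} := ⟨x₀, rfl, .single ht⟩
    rw [h, Set.mem_singleton_iff] at this
    subst this
    obtain ⟨e, -, h | h⟩ := ht <;> exact hloop e h
  · intro h
    ext y
    simp only [cluster, Set.mem_singleton_iff, exists_eq_left, Set.mem_ofPred_eq]
    refine ⟨fun hc => hc.eq_of_isolated fun e he hinc => ?_, fun hy => hy ▸ .refl⟩
    rcases hinc with rfl | rfl
    · exact h _ ⟨e, he, Or.inl rfl⟩
    · exact h _ ⟨e, he, Or.inr rfl⟩

variable [DecidableEq E]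

theorem Conn.of_update_true {e : E} {v w : V}
    (he : G.ends e = (v, w) ∨ G.ends e = (w, v))
    (h : G.Conn (Function.update ω e true) x y) :
    G.Conn (Function.update ω e false) x y ∨ G.Conn (Function.update ω e false) v y ∨
      G.Conn (Function.update ω e false) w y := by
  induction h using Relation.ReflTransGen.head_induction_on with
  | refl => exact Or.inl .refl
  | @head a c hadj _ ih =>
    rcases ih with ih | ih
    · obtain ⟨f, hf, hac⟩ := hadj
      by_cases hfe : f = e
      · subst hfe
        have : c = v ∨ c = w := by
          rcases he with he | he <;> rcases hac with hac | hac <;> rw [he] at hac <;>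
            simp only [Prod.mk.injEq] at hac <;> simp [hac]
        rcases this with rfl | rfl
        · exact Or.inr (Or.inl ih)
        · exact Or.inr (Or.inr ih)
      · refine Or.inl (Relation.ReflTransGen.head ⟨f, ?_, hac⟩ ih)
        simpa [hfe] using hf
    · exact Or.inr ih

/-- Opening an edge from `v ∈ X` to `w` amounts to adding `w` to `X`. -/
theorem update_true_mem_disconn {e : E} {v w : V} {X Y : Set V}
    (he : G.ends e = (v, w) ∨ G.ends e = (w, v)) (hv : v ∈ X) :
    Function.update ω e true ∈ G.disconn X Y ↔
      Function.update ω e false ∈ G.disconn (insert w X) Y := by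
  have hmono : ∀ f, Function.update ω e false f = true → Function.update ω e true f = true := by
    intro f
    by_cases h : f = e
    · subst h; simp
    · simp [h]
  constructor
  · rintro h x (rfl | hx) y hy hc
    · exact h v hv y hy (Relation.ReflTransGen.head ⟨e, by simp, he⟩ (hc.mono hmono))
    · exact h x hx y hy (hc.mono hmono)
  · intro h x hx y hy hc
    rcases hc.of_update_true he with hc | hc | hc
    · exact h x (Or.inr hx) y hy hc
    · exact h v (Or.inr hv) y hy hc
    · exact h w (Or.inl rfl) y hy hc

theorem Conn.of_piecewise {F : Finset E} {x₀ b : V} {S : Set V}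
    (hF : ∀ e, e ∈ F ↔ ¬ G.incident x₀ e)
    (hS : ∀ v, v ∈ S ↔ G.adj ω x₀ v) (hb : b ≠ x₀)
    (h : G.Conn (F.piecewise ω' ω) y b) :
    G.Conn (F.piecewise ω' (fun _ => false)) y b ∨
      (∃ t ∈ S, G.Conn (F.piecewise ω' (fun _ => false)) t b) ∧
      (y = x₀ ∨ ∃ t ∈ S, G.Conn (F.piecewise ω' (fun _ => false)) y t) := by
  induction h using Relation.ReflTransGen.head_induction_on with
  | refl => exact Or.inl .refl
  | @head y z hadj _ ih =>
    obtain ⟨e, he, hyz⟩ := hadj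
    by_cases heF : e ∈ F
    · have hadj' : G.adj (F.piecewise ω' (fun _ => false)) y z :=
        ⟨e, by simpa [heF] using he, hyz⟩
      have hz : z ≠ x₀ := by
        rintro rfl
        refine (hF e).1 heF ?_
        rcases hyz with h | h <;> simp [incident, h]
      rcases ih with ih | ⟨ht, ih | ⟨t, htS, ih⟩⟩
      · exact Or.inl (.head hadj' ih)
      · exact absurd ih hz
      · exact Or.inr ⟨ht, Or.inr ⟨t, htS, .head hadj' ih⟩⟩
    · have heω : ω e = true := by simpa [heF] using he
      have hinc : G.incident x₀ e := by
        by_contra h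
        exact heF ((hF e).2 h)
      by_cases hy : y = x₀
      · subst hy
        have hz : z ∈ S := (hS z).2 ⟨e, heω, hyz⟩
        rcases ih with ih | ⟨ht, _⟩
        · exact Or.inr ⟨⟨z, hz, ih⟩, Or.inl rfl⟩
        · exact Or.inr ⟨ht, Or.inl rfl⟩
      · have hz : z = x₀ := by
          rcases hyz with h | h <;> rcases hinc with h' | h' <;> simp_all
        subst hz
        have hyS : y ∈ S := (hS y).2 ⟨e, heω, hyz.symm⟩
        rcases ih with ih | ⟨ht, _⟩
        · refine absurd (ih.eq_of_isolated fun f hf => (hF f).1 ?_) hb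
          by_contra h
          simp [h] at hf
        · exact Or.inr ⟨ht, Or.inr ⟨y, hyS, .refl⟩⟩

theorem Conn.piecewise_of_adj {F : Finset E} {x₀ b t : V}
    (hF : ∀ e, e ∈ F ↔ ¬ G.incident x₀ e) (ht : G.adj ω x₀ t)
    (h : G.Conn (F.piecewise ω' (fun _ => false)) t b) :
    G.Conn (F.piecewise ω' ω) x₀ b := by
  obtain ⟨e, he, h'⟩ := ht
  have heF : e ∉ F := by
    rw [hF, not_not]
    rcases h' with h' | h' <;> simp [incident, h']
  refine .head ⟨e, by simpa [heF] using he, h'⟩ (h.mono fun f hf => ?_)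
  by_cases hfF : f ∈ F
  · simpa [hfF] using hf
  · simp [hfF] at hf

end Connectivity

section Disconnection

variable {V E : Type} [Fintype E] [DecidableEq E] (G : PercGraph V E)

/-- The probability that no open path using only edges of `F` joins `X` to `Y`. -/
noncomputable def disconnProb (F : Finset E) (X Y : Set V) : ℝ :=
  G.prob {ω | F.piecewise ω (fun _ => false) ∈ G.disconn X Y}

theorem disconnProb_comm (F : Finset E) (X Y : Set V) :
    G.disconnProb F X Y = G.disconnProb F Y X := by
  unfold disconnProb
  simp only [disconn_comm (X := X)]

variable {G}

theorem disconnProb_nonneg (hp : G.ProbValid) (F : Finset E) (X Y : Set V) :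
    0 ≤ G.disconnProb F X Y :=
  prob_nonneg hp _

theorem disconnProb_anti (hp : G.ProbValid) (F : Finset E) {X X' Y Y' : Set V}
    (hX : X ⊆ X') (hY : Y ⊆ Y') : G.disconnProb F X' Y' ≤ G.disconnProb F X Y :=
  prob_mono hp fun _ h => disconn_anti hX hY h

theorem disconnProb_eq_zero {F : Finset E} {X Y : Set V} {v : V} (hX : v ∈ X) (hY : v ∈ Y) :
    G.disconnProb F X Y = 0 := by
  rw [← prob_empty G]
  unfold disconnProb
  congr 1
  ext ω
  simp only [Set.mem_ofPred_eq, Set.mem_empty_iff_false, iff_false]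
  exact fun h => h v hX v hY .refl

theorem disconnProb_eq_one {F : Finset E} {X Y : Set V} (hXY : ∀ v ∈ X, v ∉ Y)
    (hF : ∀ e ∈ F, ∀ v ∈ X, ¬ G.incident v e) : G.disconnProb F X Y = 1 := by
  rw [← prob_univ G]
  unfold disconnProb
  congr 1
  ext ω
  simp only [Set.mem_ofPred_eq, Set.mem_univ, iff_true]
  intro x hx y hy hc
  have := hc.eq_of_isolated fun e he => hF e (by
    by_contra h
    simp [h] at he) x hx
  exact hXY x hx (this ▸ hy)

theorem disconnProb_eq_erase {F : Finset E} {X Y : Set V} {e : E} {v w : V} (heF : e ∈ F)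
    (he : G.ends e = (v, w) ∨ G.ends e = (w, v)) (hv : v ∈ X) :
    G.disconnProb F X Y = G.p e * G.disconnProb (F.erase e) (insert w X) Y +
      (1 - G.p e) * G.disconnProb (F.erase e) X Y := by
  have h₁ : ∀ (ω : E → Bool) (c : Bool),
      F.piecewise (Function.update ω e c) (fun _ => false) =
        Function.update ((F.erase e).piecewise ω (fun _ => false)) e c := by
    intro ω c
    ext j
    by_cases h : j = e
    · subst h; simp [heF]
    · by_cases hj : j ∈ F <;> simp [h, hj, Finset.piecewise]
  have h₂ : ∀ ω : E → Bool,
      Function.update ((F.erase e).piecewise ω (fun _ => false)) e false =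
        (F.erase e).piecewise ω (fun _ => false) := by
    intro ω
    simp
  unfold disconnProb
  rw [prob_eq_update G e]
  simp only [Set.mem_ofPred_eq, h₁, update_true_mem_disconn he hv, h₂]

/-- The four functions inequality on the two-point lattice. -/
theorem two_point_four_functions {p α₁ α₂ α₃ α₄ β₁ β₂ β₃ β₄ : ℝ} (hp₀ : 0 ≤ p) (hp₁ : p ≤ 1)
    (hα₁ : 0 ≤ α₁) (hα₂ : 0 ≤ α₂) (hα₃ : 0 ≤ α₃) (hα₄ : 0 ≤ α₄)
    (hβ₁ : 0 ≤ β₁) (hβ₂ : 0 ≤ β₂) (hβ₄ : 0 ≤ β₄)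
    (hαα : α₁ * α₂ ≤ α₃ * α₄) (hββ : β₁ * β₂ ≤ β₃ * β₄)
    (hαβ : α₁ * β₂ ≤ β₃ * α₄) (hβα : β₁ * α₂ ≤ β₃ * α₄) :
    (p * β₁ + (1 - p) * α₁) * (p * β₂ + (1 - p) * α₂) ≤
      (p * β₃ + (1 - p) * α₃) * (p * β₄ + (1 - p) * α₄) := by
  have hcross : α₁ * β₂ + β₁ * α₂ ≤ α₃ * β₄ + β₃ * α₄ := by
    have hx : 0 ≤ α₁ * β₂ := by positivity
    have hy : 0 ≤ β₁ * α₂ := by positivity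
    have hu : 0 ≤ α₃ * β₄ := by positivity
    have hprod : (α₁ * β₂) * (β₁ * α₂) ≤ (α₃ * β₄) * (β₃ * α₄) := by
      calc (α₁ * β₂) * (β₁ * α₂) = (α₁ * α₂) * (β₁ * β₂) := by ring
        _ ≤ (α₃ * α₄) * (β₃ * β₄) := by gcongr
        _ = _ := by ring
    generalize α₁ * β₂ = x at *
    generalize β₁ * α₂ = y at *
    generalize α₃ * β₄ = u at *
    generalize β₃ * α₄ = z at *
    rcases (hx.trans hαβ).eq_or_lt with hz | hz
    · linarith
    · by_contra! h
      nlinarith [mul_nonneg (sub_nonneg.2 hαβ) (sub_nonneg.2 hβα)]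
  have h₁ := mul_le_mul_of_nonneg_left hββ (mul_nonneg hp₀ hp₀)
  have h₂ := mul_le_mul_of_nonneg_left hαα
    (mul_nonneg (sub_nonneg.2 hp₁) (sub_nonneg.2 hp₁))
  have h₃ := mul_le_mul_of_nonneg_left hcross (mul_nonneg hp₀ (sub_nonneg.2 hp₁))
  linarith

/-- The probability of `X ↮ Y` is log-supermodular in `X` and the complement of `Y` jointly. -/
theorem disconnProb_mul_le (hp : G.ProbValid) (F : Finset E) (X₁ X₂ Y₁ Y₂ : Set V) :
    G.disconnProb F X₁ Y₁ * G.disconnProb F X₂ Y₂ ≤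
      G.disconnProb F (X₁ ∪ X₂) (Y₁ ∩ Y₂) * G.disconnProb F (X₁ ∩ X₂) (Y₁ ∪ Y₂) := by
  induction F using Finset.strongInduction generalizing X₁ X₂ Y₁ Y₂ with
  | H F ih =>
  have step : ∀ X₁ X₂ Y₁ Y₂ : Set V, (∃ e ∈ F, ∃ v ∈ X₁ ∩ X₂, G.incident v e) →
      G.disconnProb F X₁ Y₁ * G.disconnProb F X₂ Y₂ ≤
        G.disconnProb F (X₁ ∪ X₂) (Y₁ ∩ Y₂) * G.disconnProb F (X₁ ∩ X₂) (Y₁ ∪ Y₂) := by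
    rintro X₁ X₂ Y₁ Y₂ ⟨e, heF, v, hv, hev⟩
    obtain ⟨w, he⟩ : ∃ w, G.ends e = (v, w) ∨ G.ends e = (w, v) := by
      rcases hev with rfl | rfl
      · exact ⟨(G.ends e).2, Or.inl rfl⟩
      · exact ⟨(G.ends e).1, Or.inr rfl⟩
    rw [disconnProb_eq_erase heF he hv.1, disconnProb_eq_erase heF he hv.2,
      disconnProb_eq_erase heF he (Or.inl hv.1 : v ∈ X₁ ∪ X₂), disconnProb_eq_erase heF he hv]
    have IH := ih (F.erase e) (Finset.erase_ssubset heF)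
    have hnn := disconnProb_nonneg hp (F.erase e)
    refine two_point_four_functions (hp e).1 (hp e).2 (hnn _ _) (hnn _ _) (hnn _ _) (hnn _ _)
      (hnn _ _) (hnn _ _) (hnn _ _) (IH _ _ _ _) ?_ ?_ ?_
    · rw [Set.insert_inter_distrib, Set.insert_union_distrib]
      exact IH _ _ _ _
    · refine (IH _ _ _ _).trans ?_
      rw [Set.union_insert]
      exact mul_le_mul_of_nonneg_left (disconnProb_anti hp _
        (Set.inter_subset_inter_right _ (Set.subset_insert _ _)) subset_rfl) (hnn _ _)
    · refine (IH _ _ _ _).trans ?_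
      rw [Set.insert_union]
      exact mul_le_mul_of_nonneg_left (disconnProb_anti hp _
        (Set.inter_subset_inter_left _ (Set.subset_insert _ _)) subset_rfl) (hnn _ _)
  by_cases hX : ∃ e ∈ F, ∃ v ∈ X₁ ∩ X₂, G.incident v e
  · exact step _ _ _ _ hX
  by_cases hY : ∃ e ∈ F, ∃ v ∈ Y₁ ∩ Y₂, G.incident v e
  · have := step Y₁ Y₂ X₁ X₂ hY
    rw [disconnProb_comm G F X₁, disconnProb_comm G F X₂, disconnProb_comm G F (X₁ ∪ X₂),
      disconnProb_comm G F (X₁ ∩ X₂)]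
    linarith
  push Not at hX hY
  by_cases h₁ : ∃ v ∈ X₁, v ∈ Y₁
  · obtain ⟨v, hv, hv'⟩ := h₁
    rw [disconnProb_eq_zero hv hv', zero_mul]
    exact mul_nonneg (disconnProb_nonneg hp _ _ _) (disconnProb_nonneg hp _ _ _)
  by_cases h₂ : ∃ v ∈ X₂, v ∈ Y₂
  · obtain ⟨v, hv, hv'⟩ := h₂
    rw [disconnProb_eq_zero hv hv', mul_zero]
    exact mul_nonneg (disconnProb_nonneg hp _ _ _) (disconnProb_nonneg hp _ _ _)
  push Not at h₁ h₂
  have hle : ∀ X Y, G.disconnProb F X Y ≤ 1 := fun X Y =>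
    (prob_mono hp (Set.subset_univ _)).trans_eq (prob_univ G)
  rw [disconnProb_comm G F (X₁ ∪ X₂),
    disconnProb_eq_one (X := Y₁ ∩ Y₂) (by
      rintro v hv (h | h)
      · exact h₁ v h hv.1
      · exact h₂ v h hv.2) hY,
    disconnProb_eq_one (X := X₁ ∩ X₂) (by
      rintro v hv (h | h)
      · exact h₁ v hv.1 h
      · exact h₂ v hv.2 h) hX, mul_one]
  exact mul_le_one₀ (hle _ _) (disconnProb_nonneg hp _ _ _) (hle _ _)

/-- If `t ∈ S` is at least as likely as `s` to be connected to `b`, then conditionally on `s ↮ S`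
the set `S` is at least as likely as `s` to be connected to `b`. -/
theorem disconnProb_pair_le (hp : G.ProbValid) (F : Finset E) {s t b : V} {S : Set V}
    (ht : t ∈ S) (hst : G.disconnProb F {t} {b} ≤ G.disconnProb F {s} {b}) :
    G.disconnProb F {s, b} S ≤ G.disconnProb F {s} (insert b S) := by
  have h₁ := disconnProb_mul_le hp F {s} {s} {t, b} S
  have h₂ := disconnProb_mul_le hp F {s, b} {s} S {t}
  have hsplit : ∀ x y : V, G.disconnProb F {x} {y, b} +
      G.prob ({ω | F.piecewise ω (fun _ => false) ∈ G.disconn {x} {b}} \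
        {ω | F.piecewise ω (fun _ => false) ∈ G.disconn {x} {y}}) = G.disconnProb F {x} {b} := by
    intro x y
    unfold disconnProb
    rw [← prob_inter_add_diff G {ω | F.piecewise ω (fun _ => false) ∈ G.disconn {x} {b}}
      {ω | F.piecewise ω (fun _ => false) ∈ G.disconn {x} {y}}]
    congr 2
    ext ω
    simp [disconn, and_comm]
  have hdiff : {ω | F.piecewise ω (fun _ => false) ∈ G.disconn {s} {b}} \
        {ω | F.piecewise ω (fun _ => false) ∈ G.disconn {s} {t}} =
      {ω | F.piecewise ω (fun _ => false) ∈ G.disconn {t} {b}} \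
        {ω | F.piecewise ω (fun _ => false) ∈ G.disconn {t} {s}} := by
    ext ω
    simp only [disconn, Set.mem_sdiff, Set.mem_ofPred_eq, Set.mem_singleton_iff, forall_eq,
      not_not]
    exact ⟨fun ⟨h, h'⟩ => ⟨fun hc => h (h'.trans hc), h'.symm⟩,
      fun ⟨h, h'⟩ => ⟨fun hc => h (h'.trans hc), h'.symm⟩⟩
  have h₃ : G.disconnProb F {s, b} {t} ≤ G.disconnProb F {s} {t, b} := by
    have hs := hsplit s t
    have ht := hsplit t s
    rw [hdiff] at hs
    rw [disconnProb_comm G F {s, b}]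
    linarith
  have e₁ : ({t, b} ∩ S : Set V) ⊇ {t} := by simpa using ht
  have e₂ : ({t, b} ∪ S : Set V) = insert b S := by
    ext v
    simp only [Set.mem_union, Set.mem_insert_iff, Set.mem_singleton_iff]
    constructor
    · rintro ((rfl | rfl) | h) <;> simp_all
    · rintro (rfl | h) <;> simp_all
  have e₃ : ({s, b} ∪ {s} : Set V) = {s, b} := by simp
  have e₄ : ({s, b} ∩ {s} : Set V) = {s} := by simp
  have e₅ : (S ∩ {t} : Set V) = {t} := by simpa using ht
  have e₆ : (S ∪ {t} : Set V) = S := by simpa using ht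
  rw [e₂, Set.union_self, Set.inter_self] at h₁
  rw [e₃, e₄, e₅, e₆] at h₂
  have hnn := disconnProb_nonneg hp F
  have h₁' := h₁.trans (mul_le_mul_of_nonneg_right
    (disconnProb_anti hp F subset_rfl e₁) (hnn {s} (insert b S)))
  rcases (hnn {s} {t}).eq_or_lt with h | h
  · calc G.disconnProb F {s, b} S ≤ G.disconnProb F {s} {t} :=
          disconnProb_anti hp F (by simp) (by simpa using ht)
      _ ≤ _ := by rw [← h]; exact hnn _ _
  · refine le_of_mul_le_mul_right ?_ h
    have := mul_le_mul_of_nonneg_right h₃ (hnn {s} S)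
    linarith

end Disconnection

section Isolated

variable {V E : Type} [Fintype E] [DecidableEq E] {G : PercGraph V E}

/-- Given the states of the edges at `x₀`, the edge to `t` being open, `x₀` is at least as likely
as `s` to be connected to `b`, provided `s` is at most as likely as `t` to be so off `x₀`. -/
theorem prob_conn_piecewise_le (hp : G.ProbValid) {F : Finset E} {x₀ b s t : V} {ω : E → Bool}
    (hF : ∀ e, e ∈ F ↔ ¬ G.incident x₀ e) (hb : b ≠ x₀) (hs : s ≠ x₀) (ht : G.adj ω x₀ t)
    (hst : G.prob {ω' | G.Conn (F.piecewise ω' (fun _ => false)) s b} ≤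
      G.prob {ω' | G.Conn (F.piecewise ω' (fun _ => false)) t b}) :
    G.prob {ω' | G.Conn (F.piecewise ω' ω) s b} ≤
      G.prob {ω' | G.Conn (F.piecewise ω' ω) x₀ b} := by
  set S : Set V := {v | G.adj ω x₀ v} with hS
  have hcompl : ∀ x, G.disconnProb F {x} {b} =
      1 - G.prob {ω' | G.Conn (F.piecewise ω' (fun _ => false)) x b} := by
    intro x
    rw [eq_sub_iff_add_eq', ← prob_univ G, ← prob_inter_add_diff G Set.univ
      {ω' | G.Conn (F.piecewise ω' (fun _ => false)) x b}]
    unfold disconnProb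
    congr 2
    · simp
    · ext ω'; simp [disconn]
  have key := disconnProb_pair_le hp F (s := s) (t := t) (b := b) (S := S) ht
    (by rw [hcompl, hcompl]; linarith)
  set Es : Set (E → Bool) := {ω' | G.Conn (F.piecewise ω' (fun _ => false)) s b}
  set ES : Set (E → Bool) := {ω' | ∃ t ∈ S, G.Conn (F.piecewise ω' (fun _ => false)) t b}
  set D : Set (E → Bool) := {ω' | F.piecewise ω' (fun _ => false) ∈ G.disconn {s} S}
  have h₁ : G.prob (D ∩ Es) + G.disconnProb F {s} (insert b S) = G.prob D := by
    rw [← prob_inter_add_diff G D Es]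
    unfold disconnProb
    congr 2
    ext ω'
    simp [disconn, D, Es, and_comm]
  have h₂ : G.prob (D ∩ ES) + G.disconnProb F {s, b} S = G.prob D := by
    rw [← prob_inter_add_diff G D ES]
    unfold disconnProb
    congr 2
    ext ω'
    simp only [disconn, D, ES, Set.mem_ofPred_eq, Set.mem_sdiff, Set.mem_insert_iff,
      Set.mem_singleton_iff, forall_eq_or_imp, forall_eq, not_exists, not_and]
    exact and_congr_right fun _ => ⟨fun h t ht hc => h t ht hc.symm,
      fun h t ht hc => h t ht hc.symm⟩
  have h₃ : G.prob {ω' | G.Conn (F.piecewise ω' ω) s b} ≤ G.prob (D ∩ Es) + G.prob (ES \ D) := by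
    rw [← prob_inter_add_diff G {ω' | G.Conn (F.piecewise ω' ω) s b} D]
    have hpw : ∀ ω', G.Conn (F.piecewise ω' ω) s b → _ := fun ω' h =>
      h.of_piecewise (S := S) hF (fun _ => Iff.rfl) hb
    refine add_le_add (prob_mono hp ?_) (prob_mono hp ?_)
    · rintro ω' ⟨h, hD⟩
      rcases hpw ω' h with h | ⟨_, h | ⟨t, ht, h⟩⟩
      · exact ⟨hD, h⟩
      · exact absurd h hs
      · exact absurd h (hD s rfl t ht)
    · rintro ω' ⟨h, hD⟩
      refine ⟨?_, hD⟩
      rcases hpw ω' h with h | ⟨h, _⟩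
      · have : ∃ t ∈ S, G.Conn (F.piecewise ω' (fun _ => false)) s t := by
          by_contra! hn
          exact hD fun x hx t ht => by rw [Set.mem_singleton_iff.1 hx]; exact hn t ht
        obtain ⟨t, ht, hc⟩ := this
        exact ⟨t, ht, hc.symm.trans h⟩
      · exact h
  have h₄ : G.prob ES ≤ G.prob {ω' | G.Conn (F.piecewise ω' ω) x₀ b} :=
    prob_mono hp fun ω' ⟨_, ht, h⟩ => h.piecewise_of_adj hF ht
  have h₅ := prob_inter_add_diff G ES D
  rw [Set.inter_comm] at h₅
  linarith

theorem prob_delete_connEvent [DecidableEq V] (x₀ a b : V) {F : Finset E}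
    (hF : ∀ e, e ∈ F ↔ ¬ G.incident x₀ e) :
    (G.delete {x₀}).prob ((G.delete {x₀}).connEvent a b) =
      G.prob {ω | G.Conn (F.piecewise ω (fun _ => false)) a b} := by
  rw [prob_delete]
  congr 1
  ext ω
  simp only [connEvent, Set.mem_ofPred_eq, Conn]
  refine iff_of_eq (congrArg (fun r => Relation.ReflTransGen r a b) ?_)
  ext x y
  constructor
  · rintro ⟨⟨e, h₁, h₂⟩, he, h⟩
    have : e ∈ F := (hF e).2 (by simpa [incident] using And.intro h₁ h₂)
    exact ⟨e, by simpa [this] using he, h⟩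
  · rintro ⟨e, he, h⟩
    by_cases heF : e ∈ F
    · have := (hF e).1 heF
      refine ⟨⟨e, by simpa [incident] using this⟩, by simpa [heF] using he, h⟩
    · simp [heF] at he

theorem prob_connEvent_le (hp : G.ProbValid) {F : Finset E} {x₀ b s : V}
    (hF : ∀ e, e ∈ F ↔ ¬ G.incident x₀ e) (hb : b ≠ x₀) (hs : s ≠ x₀)
    (hmin : ∀ e t, G.ends e = (x₀, t) ∨ G.ends e = (t, x₀) →
      t ≠ x₀ ∧ G.prob {ω | G.Conn (F.piecewise ω (fun _ => false)) s b} ≤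
        G.prob {ω | G.Conn (F.piecewise ω (fun _ => false)) t b}) :
    G.prob (G.connEvent s b) ≤ G.prob {ω | G.cluster ω {x₀} = {x₀}} *
      G.prob {ω | G.Conn (F.piecewise ω (fun _ => false)) s b} + G.prob (G.connEvent x₀ b) := by
  classical
  have hloop : ∀ e, G.ends e ≠ (x₀, x₀) := fun e he => (hmin e x₀ (Or.inl he)).1 rfl
  rw [prob_eq_resample G F (G.connEvent s b), prob_eq_resample G F (G.connEvent x₀ b),
    prob_eq_expec G {ω | G.cluster ω {x₀} = {x₀}}]
  simp only [expec, Finset.sum_mul, ← Finset.sum_add_distrib]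
  refine Finset.sum_le_sum fun ω _ => ?_
  rw [mul_right_comm, ← add_mul]
  refine mul_le_mul_of_nonneg_right ?_ (weight_nonneg hp ω)
  simp only [connEvent, Set.mem_ofPred_eq, Set.indicator_apply, cluster_singleton_eq_iff hloop,
    Pi.one_apply]
  split_ifs with h
  · have hle : G.prob {ω' | G.Conn (F.piecewise ω' ω) s b} ≤
        G.prob {ω' | G.Conn (F.piecewise ω' (fun _ => false)) s b} := by
      refine prob_mono hp fun ω' hc => ?_
      rcases Conn.of_piecewise (S := {v | G.adj ω x₀ v}) hF (fun _ => Iff.rfl) hb hc with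
        hc | ⟨⟨t, ht, -⟩, -⟩
      · exact hc
      · exact absurd ht (h t)
    have := prob_nonneg hp {ω' | G.Conn (F.piecewise ω' ω) x₀ b}
    linarith
  · push Not at h
    obtain ⟨t, ht⟩ := h
    rw [zero_mul, zero_add]
    obtain ⟨e, -, he⟩ := id ht
    exact prob_conn_piecewise_le hp hF hb hs ht (hmin e t he).2

end Isolated

end PercGraph

/-- if `0` and `b` lie in disjoint components of `G∖A` and `0` is
isolated in `G∖A` (every edge from `0` goes into `A`), then `(G,A,0,b)` is good. -/
theorem good_of_isolated
    {V E : Type} [Fintype V] [DecidableEq V] [Fintype E] [DecidableEq E]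
    (G : PercGraph V E) (hp : G.ProbValid) (A : Finset V) (hA : A.Nonempty)
    (x₀ b : V)
    (hdisj : ¬ (G.delete A).Conn (fun _ => true) x₀ b)
    (hiso : ∀ e, G.incident x₀ e → G.otherEnd x₀ e ∈ A) :
    G.Good A hA x₀ b := by
  classical
  have hterm : ∀ W : Finset V, 0 ≤ G.prob {ω | G.cluster ω {x₀} = ↑W} *
      A.inf' hA (fun a => (G.delete W).prob ((G.delete W).connEvent a b)) := fun W =>
    mul_nonneg (PercGraph.prob_nonneg hp _) (Finset.le_inf' _ _ fun a _ =>
      PercGraph.prob_nonneg (G := G.delete W) (fun e => hp e.1) _)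
  unfold PercGraph.Good
  by_cases hx : x₀ ∈ A
  · have h₁ := Finset.inf'_le (fun a => G.prob (G.connEvent a b)) hx
    have h₂ := Finset.sum_nonneg fun W (_ : W ∈ Finset.univ.filter
      (fun W : Finset V => W ∩ A = ∅)) => hterm W
    linarith
  have hb : b ≠ x₀ := by
    rintro rfl
    exact hdisj .refl
  have hsum := Finset.single_le_sum (fun W _ => hterm W)
    (show ({x₀} : Finset V) ∈ Finset.univ.filter (fun W : Finset V => W ∩ A = ∅) by
      simp [Finset.singleton_inter_of_notMem hx])
  obtain ⟨s, hsA, hs⟩ := Finset.exists_mem_eq_inf' hA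
    (fun a => (G.delete {x₀}).prob ((G.delete {x₀}).connEvent a b))
  have hF : ∀ e, e ∈ Finset.univ.filter (fun e => ¬ G.incident x₀ e) ↔ ¬ G.incident x₀ e := by
    simp
  have key := PercGraph.prob_connEvent_le hp hF hb (fun h => hx (h ▸ hsA) : s ≠ x₀) (by
    intro e t he
    have htA : t ∈ A := by
      have := hiso e (by rcases he with he | he <;> simp [PercGraph.incident, he])
      rcases he with he | he
      · simpa [PercGraph.otherEnd, he] using this
      · by_cases htx : t = x₀
        · simpa [PercGraph.otherEnd, he, htx] using this
        · simpa [PercGraph.otherEnd, he, htx] using this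
    refine ⟨fun h => hx (h ▸ htA), ?_⟩
    rw [← PercGraph.prob_delete_connEvent x₀ s b hF, ← PercGraph.prob_delete_connEvent x₀ t b hF,
      ← hs]
    exact Finset.inf'_le _ htA)
  rw [← PercGraph.prob_delete_connEvent x₀ s b hF, ← hs] at key
  have hmin := Finset.inf'_le (fun a => G.prob (G.connEvent a b)) hsA
  simp only [Finset.coe_singleton] at hsum
  linarith
end

section
/- Let G be a finite graph, A a set of vertices, x ∉ A a vertex and 0 a vertex such that 0 is isolated in G∖(A∪{x}) (all edges from 0 go into A∪{x}), with 0 and b in disjoint components of G∖A. If the quadruple (G∖{0}, A, x, b) is good, then (G, A, 0, b) is good. -/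
open scoped BigOperators

namespace PercGraph

section Linked

variable {V E : Type}

/-- Connection through the edges of `T`. -/
def Linked (G : PercGraph V E) (T : Finset E) : V → V → Prop :=
  Relation.ReflTransGen (fun u v => ∃ e ∈ T, G.ends e = (u, v) ∨ G.ends e = (v, u))

/-- No vertex of `X` is connected to `a` through the edges of `T`. -/
def Separated (G : PercGraph V E) (a : V) (X : Set V) (T : Finset E) : Prop :=
  ∀ y ∈ X, ¬ G.Linked T a y

/-- Some vertex of `X` is connected to `b` through the edges of `T`. -/
def LinkedSet (G : PercGraph V E) (X : Set V) (b : V) (T : Finset E) : Prop :=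
  ∃ y ∈ X, G.Linked T y b

variable {G : PercGraph V E}

lemma Linked.mono {S T : Finset E} (h : S ⊆ T) {u v : V} (huv : G.Linked S u v) :
    G.Linked T u v :=
  Relation.ReflTransGen.mono (fun _ _ ⟨e, he, h'⟩ => ⟨e, h he, h'⟩) _ _ huv

lemma Linked.symm {T : Finset E} {u v : V} (h : G.Linked T u v) : G.Linked T v u := by
  have : Std.Symm (fun u v => ∃ e ∈ T, G.ends e = (u, v) ∨ G.ends e = (v, u)) :=
    ⟨fun _ _ ⟨e, he, h'⟩ => ⟨e, he, h'.symm⟩⟩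
  exact Relation.ReflTransGen.stdSymm.symm _ _ h

lemma Linked.trans {T : Finset E} {u v w : V} (h : G.Linked T u v) (h' : G.Linked T v w) :
    G.Linked T u w :=
  Relation.ReflTransGen.trans h h'

lemma Linked.of_mem {T : Finset E} {e : E} {u v : V} (he : e ∈ T)
    (h : G.ends e = (u, v) ∨ G.ends e = (v, u)) : G.Linked T u v :=
  Relation.ReflTransGen.single ⟨e, he, h⟩

lemma Linked.refl (T : Finset E) (u : V) : G.Linked T u u := Relation.ReflTransGen.refl

lemma Linked.eq_of_isolated {T : Finset E} {u v : V} (h : G.Linked T u v)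
    (hu : ∀ e ∈ T, ¬ G.incident u e) : v = u := by
  rcases Relation.ReflTransGen.cases_head h with h | ⟨w, ⟨e, he, h'⟩, -⟩
  · exact h.symm
  · refine absurd ?_ (hu e he)
    rcases h' with h' | h' <;> simp [incident, h']

lemma exists_ends_of_incident {z : V} {e : E} (h : G.incident z e) :
    ∃ v, G.ends e = (z, v) ∨ G.ends e = (v, z) := by
  rcases h with h | h
  · exact ⟨(G.ends e).2, Or.inl (by rw [← h])⟩
  · exact ⟨(G.ends e).1, Or.inr (by rw [← h])⟩

lemma separated_antitone (a : V) (X : Set V) : Antitone (G.Separated a X) :=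
  fun _ _ h hT y hy hl => hT y hy (hl.mono h)

lemma Separated.subset {a : V} {X Y : Set V} {T : Finset E} (h : G.Separated a Y T)
    (hXY : X ⊆ Y) : G.Separated a X T :=
  fun y hy => h y (hXY hy)

lemma LinkedSet.subset {b : V} {X Y : Set V} {T : Finset E} (h : G.LinkedSet X b T)
    (hXY : X ⊆ Y) : G.LinkedSet Y b T :=
  let ⟨y, hy, hl⟩ := h
  ⟨y, hXY hy, hl⟩

lemma separated_union {a : V} {X Y : Set V} {T : Finset E} :
    G.Separated a (X ∪ Y) T ↔ G.Separated a X T ∧ G.Separated a Y T := by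
  simp only [Separated, Set.mem_union, or_imp, forall_and]

lemma separated_of_isolated {a : V} {X : Set V} {T : Finset E} (ha : a ∉ X)
    (hX : ∀ e ∈ T, ∀ z ∈ X, ¬ G.incident z e) : G.Separated a X T := by
  intro y hy hl
  have := hl.symm.eq_of_isolated fun e he => hX e he y hy
  exact ha (this ▸ hy)

end Linked

section LiveEdges

variable {V E : Type} [DecidableEq E]

/-- Expectation of `f` applied to the set of open edges, when only the edges of `L` are present. -/
noncomputable def expecOn (G : PercGraph V E) (L : Finset E) (f : Finset E → ℝ) : ℝ :=
  ∑ T ∈ L.powerset, ((∏ e ∈ T, G.p e) * ∏ e ∈ L \ T, (1 - G.p e)) * f T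

open Classical in
/-- Probability of an event for the set of open edges, when only the edges of `L` are present. -/
noncomputable def probOn (G : PercGraph V E) (L : Finset E) (Q : Finset E → Prop) : ℝ :=
  G.expecOn L (fun T => if Q T then 1 else 0)

variable {G : PercGraph V E}

lemma expecOn_empty (f : Finset E → ℝ) : G.expecOn ∅ f = f ∅ := by
  simp [expecOn]

lemma expecOn_insert {e : E} {L : Finset E} (he : e ∉ L) (f : Finset E → ℝ) :
    G.expecOn (insert e L) f =
      G.p e * G.expecOn L (fun T => f (insert e T)) + (1 - G.p e) * G.expecOn L f := by
  unfold expecOn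
  rw [Finset.sum_powerset_insert he, add_comm, Finset.mul_sum, Finset.mul_sum]
  congr 1
  · refine Finset.sum_congr rfl fun T hT => ?_
    have heT : e ∉ T := fun h => he (Finset.mem_powerset.1 hT h)
    rw [Finset.prod_insert heT, Finset.insert_sdiff_insert, Finset.sdiff_insert_of_notMem he]
    ring
  · refine Finset.sum_congr rfl fun T hT => ?_
    have heT : e ∉ T := fun h => he (Finset.mem_powerset.1 hT h)
    rw [Finset.insert_sdiff_of_notMem _ heT, Finset.prod_insert (by simp [he])]
    ring

lemma expecOn_mono (hp : G.ProbValid) {L : Finset E} {f g : Finset E → ℝ}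
    (h : ∀ T ⊆ L, f T ≤ g T) : G.expecOn L f ≤ G.expecOn L g := by
  refine Finset.sum_le_sum fun T hT => mul_le_mul_of_nonneg_left (h T (Finset.mem_powerset.1 hT)) ?_
  exact mul_nonneg (Finset.prod_nonneg fun e _ => (hp e).1)
    (Finset.prod_nonneg fun e _ => sub_nonneg.2 (hp e).2)

lemma expecOn_congr {L : Finset E} {f g : Finset E → ℝ}
    (h : ∀ T ⊆ L, f T = g T) : G.expecOn L f = G.expecOn L g :=
  Finset.sum_congr rfl fun T hT => by rw [h T (Finset.mem_powerset.1 hT)]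

lemma expecOn_add (L : Finset E) (f g : Finset E → ℝ) :
    G.expecOn L (fun T => f T + g T) = G.expecOn L f + G.expecOn L g := by
  simp [expecOn, mul_add, Finset.sum_add_distrib]

lemma expecOn_const (L : Finset E) (c : ℝ) : G.expecOn L (fun _ => c) = c := by
  induction L using Finset.induction_on with
  | empty => exact expecOn_empty _
  | insert e L he ih => rw [expecOn_insert he, ih]; ring

lemma expecOn_union {L M : Finset E} (h : Disjoint L M) (f : Finset E → ℝ) :
    G.expecOn (L ∪ M) f = G.expecOn M (fun S => G.expecOn L (fun T => f (T ∪ S))) := by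
  induction M using Finset.induction_on generalizing f with
  | empty => simp [expecOn_empty]
  | insert e M he ih =>
    rw [Finset.disjoint_insert_right] at h
    rw [Finset.union_insert, expecOn_insert (by simp [h.1, he]), expecOn_insert he,
      ih h.2, ih h.2]
    simp only [Finset.union_insert]

lemma probOn_insert {e : E} {L : Finset E} (he : e ∉ L) (Q : Finset E → Prop) :
    G.probOn (insert e L) Q =
      G.p e * G.probOn L (fun T => Q (insert e T)) + (1 - G.p e) * G.probOn L Q :=
  expecOn_insert he _

lemma probOn_mono (hp : G.ProbValid) {L : Finset E} {Q R : Finset E → Prop}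
    (h : ∀ T ⊆ L, Q T → R T) : G.probOn L Q ≤ G.probOn L R := by
  refine expecOn_mono hp fun T hT => ?_
  split_ifs with hQ hR
  · exact le_rfl
  · exact absurd (h T hT hQ) hR
  · exact zero_le_one
  · exact le_rfl

lemma probOn_congr {L : Finset E} {Q R : Finset E → Prop}
    (h : ∀ T ⊆ L, (Q T ↔ R T)) : G.probOn L Q = G.probOn L R :=
  expecOn_congr fun T hT => by rw [propext (h T hT)]

lemma probOn_of_forall {L : Finset E} {Q : Finset E → Prop} (h : ∀ T ⊆ L, Q T) :
    G.probOn L Q = 1 := by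
  rw [← expecOn_const (G := G) L 1]
  exact expecOn_congr fun T hT => if_pos (h T hT)

lemma probOn_of_forall_not {L : Finset E} {Q : Finset E → Prop} (h : ∀ T ⊆ L, ¬ Q T) :
    G.probOn L Q = 0 := by
  rw [← expecOn_const (G := G) L 0]
  exact expecOn_congr fun T hT => if_neg (h T hT)

lemma expecOn_nonneg (hp : G.ProbValid) {L : Finset E} {f : Finset E → ℝ} (h : ∀ T ⊆ L, 0 ≤ f T) :
    0 ≤ G.expecOn L f := by
  rw [← expecOn_const (G := G) L 0]
  exact expecOn_mono hp h

lemma probOn_nonneg (hp : G.ProbValid) (L : Finset E) (Q : Finset E → Prop) :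
    0 ≤ G.probOn L Q :=
  expecOn_nonneg hp fun T _ => by split_ifs <;> norm_num

lemma probOn_le_one (hp : G.ProbValid) (L : Finset E) (Q : Finset E → Prop) :
    G.probOn L Q ≤ 1 := by
  rw [← expecOn_const (G := G) L 1]
  exact expecOn_mono hp fun T _ => by split_ifs <;> norm_num

lemma probOn_and_add_and_not (L : Finset E) (Q R : Finset E → Prop) :
    G.probOn L (fun T => Q T ∧ R T) + G.probOn L (fun T => Q T ∧ ¬ R T) = G.probOn L Q := by
  unfold probOn
  rw [← expecOn_add]
  refine expecOn_congr fun T _ => ?_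
  by_cases hQ : Q T <;> by_cases hR : R T <;> simp [hQ, hR]

/-- The Harris inequality for decreasing events. -/
lemma probOn_mul_le_probOn_and (hp : G.ProbValid) {Q R : Finset E → Prop}
    (hQ : Antitone Q) (hR : Antitone R) (L : Finset E) :
    G.probOn L Q * G.probOn L R ≤ G.probOn L (fun T => Q T ∧ R T) := by
  induction L using Finset.induction_on generalizing Q R with
  | empty =>
    simp only [probOn, expecOn_empty]
    by_cases hQ : Q ∅ <;> by_cases hR : R ∅ <;> simp [hQ, hR]
  | insert e L he ih =>
    rw [probOn_insert he, probOn_insert he, probOn_insert he]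
    have hQ1 : Antitone fun T => Q (insert e T) :=
      fun S T h => hQ (Finset.insert_subset_insert e h)
    have hR1 : Antitone fun T => R (insert e T) :=
      fun S T h => hR (Finset.insert_subset_insert e h)
    have h1 := ih hQ1 hR1
    have h0 := ih hQ hR
    have hq : G.probOn L (fun T => Q (insert e T)) ≤ G.probOn L Q :=
      probOn_mono hp fun T _ h => hQ (Finset.subset_insert e T) h
    have hr : G.probOn L (fun T => R (insert e T)) ≤ G.probOn L R :=
      probOn_mono hp fun T _ h => hR (Finset.subset_insert e T) h
    obtain ⟨p0, p1⟩ := hp e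
    have h2 := mul_nonneg (mul_nonneg p0 (sub_nonneg.2 p1))
      (mul_nonneg (sub_nonneg.2 hq) (sub_nonneg.2 hr))
    have h3 := mul_le_mul_of_nonneg_left h1 p0
    have h4 := mul_le_mul_of_nonneg_left h0 (sub_nonneg.2 p1)
    linarith

lemma probOn_and_le_mul (hp : G.ProbValid) {Q R : Finset E → Prop}
    (hQ : Monotone Q) (hR : Antitone R) (L : Finset E) :
    G.probOn L (fun T => Q T ∧ R T) ≤ G.probOn L Q * G.probOn L R := by
  have hQ' : Antitone fun T => ¬ Q T := fun S T h hT hS => hT (hQ h hS)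
  have h := probOn_mul_le_probOn_and hp hQ' hR L
  have h1 := probOn_and_add_and_not (G := G) L R Q
  have h2 := probOn_and_add_and_not (G := G) L (fun _ => True) Q
  rw [probOn_of_forall (Q := fun _ => True) (fun _ _ => trivial)] at h2
  simp only [true_and] at h2
  simp only [and_comm (a := R _)] at h1
  have h3 : G.probOn L (fun T => ¬ Q T) = 1 - G.probOn L Q := by linarith
  rw [h3] at h
  linarith

lemma Linked.of_insert {T : Finset E} {e : E} {z v u w : V}
    (he : G.ends e = (z, v) ∨ G.ends e = (v, z)) (h : G.Linked (insert e T) u w) :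
    G.Linked T u w ∨ ((G.Linked T u z ∨ G.Linked T u v) ∧ (G.Linked T z w ∨ G.Linked T v w)) := by
  induction h with
  | refl => exact Or.inl (.refl _ _)
  | @tail w w' _ hw ih =>
    obtain ⟨f, hf, hends⟩ := hw
    rcases Finset.mem_insert.1 hf with rfl | hf
    · have hcases : (w = z ∧ w' = v) ∨ (w = v ∧ w' = z) := by
        rcases he with he | he <;> rw [he] at hends <;> simp only [Prod.mk.injEq] at hends <;>
          grind
      rcases hcases with ⟨rfl, rfl⟩ | ⟨rfl, rfl⟩
      · exact Or.inr ⟨by grind, Or.inr (.refl _ _)⟩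
      · exact Or.inr ⟨by grind, Or.inl (.refl _ _)⟩
    · have hstep : G.Linked T w w' := .of_mem hf hends
      rcases ih with ih | ⟨ih, ih'⟩
      · exact Or.inl (ih.trans hstep)
      · exact Or.inr ⟨ih, ih'.imp (·.trans hstep) (·.trans hstep)⟩

section Insert

variable {e : E} {z v : V} {X : Set V} (he : G.ends e = (z, v) ∨ G.ends e = (v, z)) (hz : z ∈ X)

include he hz

lemma separated_insert_iff (a : V) (T : Finset E) :
    G.Separated a X (insert e T) ↔ G.Separated a (insert v X) T := by
  constructor
  · rintro h y (rfl | hy) hl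
    · exact h z hz ((hl.mono (Finset.subset_insert e T)).trans
        (.of_mem (Finset.mem_insert_self e T) he.symm))
    · exact h y hy (hl.mono (Finset.subset_insert e T))
  · intro h y hy hl
    rcases hl.of_insert he with hl | ⟨hl | hl, -⟩
    · exact h y (Or.inr hy) hl
    · exact h z (Or.inr hz) hl
    · exact h v (Or.inl rfl) hl

lemma linked_and_separated_insert_iff (a b : V) (T : Finset E) :
    G.Linked (insert e T) a b ∧ G.Separated a X (insert e T) ↔
      G.Linked T a b ∧ G.Separated a (insert v X) T := by
  rw [separated_insert_iff he hz]
  refine and_congr_left fun h => ⟨fun hl => ?_, fun hl => hl.mono (Finset.subset_insert e T)⟩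
  rcases hl.of_insert he with hl | ⟨hl | hl, -⟩
  · exact hl
  · exact absurd hl (h z (Or.inr hz))
  · exact absurd hl (h v (Or.inl rfl))

lemma linkedSet_insert_iff (b : V) (T : Finset E) :
    G.LinkedSet X b (insert e T) ↔ G.LinkedSet (insert v X) b T := by
  constructor
  · rintro ⟨y, hy, hl⟩
    rcases hl.of_insert he with hl | ⟨-, hl | hl⟩
    · exact ⟨y, Or.inr hy, hl⟩
    · exact ⟨z, Or.inr hz, hl⟩
    · exact ⟨v, Or.inl rfl, hl⟩
  · rintro ⟨y, rfl | hy, hl⟩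
    · exact ⟨z, hz, .trans (.of_mem (Finset.mem_insert_self e T) he)
        (hl.mono (Finset.subset_insert e T))⟩
    · exact ⟨y, hy, hl.mono (Finset.subset_insert e T)⟩

end Insert

/-- The four functions theorem on a two-point space. -/
lemma four_functions_two_points {p a₀ a₁ b₀ b₁ c₀ c₁ d₀ d₁ : ℝ} (hp₀ : 0 ≤ p) (hp₁ : p ≤ 1)
    (ha₁ : 0 ≤ a₁) (hb₁ : 0 ≤ b₁)
    (hc₀ : 0 ≤ c₀) (hc₁ : 0 ≤ c₁) (hd₀ : 0 ≤ d₀) (hd₁ : 0 ≤ d₁)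
    (h₀₀ : a₀ * b₀ ≤ c₀ * d₀) (h₀₁ : a₀ * b₁ ≤ c₁ * d₀) (h₁₀ : a₁ * b₀ ≤ c₁ * d₀)
    (h₁₁ : a₁ * b₁ ≤ c₁ * d₁) :
    (p * a₁ + (1 - p) * a₀) * (p * b₁ + (1 - p) * b₀) ≤
      (p * c₁ + (1 - p) * c₀) * (p * d₁ + (1 - p) * d₀) := by
  have hcross : a₀ * b₁ + a₁ * b₀ ≤ c₁ * d₀ + c₀ * d₁ := by
    have hprod : (a₀ * b₁) * (a₁ * b₀) ≤ (c₁ * d₀) * (c₀ * d₁) := by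
      calc (a₀ * b₁) * (a₁ * b₀) = (a₀ * b₀) * (a₁ * b₁) := by ring
        _ ≤ (c₀ * d₀) * (c₁ * d₁) :=
          mul_le_mul h₀₀ h₁₁ (mul_nonneg ha₁ hb₁) (mul_nonneg hc₀ hd₀)
        _ = _ := by ring
    have hw : 0 ≤ c₀ * d₁ := mul_nonneg hc₀ hd₁
    rcases (mul_nonneg hc₁ hd₀).eq_or_lt with h | h
    · linarith
    · by_contra! hlt
      nlinarith [mul_nonneg (sub_nonneg.2 h₀₁) (sub_nonneg.2 h₁₀)]
  have h1 := mul_le_mul_of_nonneg_left h₁₁ (mul_nonneg hp₀ hp₀)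
  have h2 := mul_le_mul_of_nonneg_left h₀₀ (mul_nonneg (sub_nonneg.2 hp₁) (sub_nonneg.2 hp₁))
  have h3 := mul_le_mul_of_nonneg_left hcross (mul_nonneg hp₀ (sub_nonneg.2 hp₁))
  linarith

/-- Positive association of the cluster of `a` conditioned on being separated from a set. -/
theorem probOn_linked_separated_mul_le (hp : G.ProbValid) (a b : V) (L : Finset E) (X Y : Set V) :
    G.probOn L (fun T => G.Linked T a b ∧ G.Separated a X T) * G.probOn L (G.Separated a Y) ≤
      G.probOn L (G.Separated a (X ∪ Y)) *
        G.probOn L (fun T => G.Linked T a b ∧ G.Separated a (X ∩ Y) T) := by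
  induction L using Finset.strongInduction generalizing X Y with
  | H L ih =>
    by_cases h : ∃ e ∈ L, ∃ z ∈ X ∩ Y, G.incident z e
    · obtain ⟨e, heL, z, hz, hze⟩ := h
      obtain ⟨v, he⟩ := exists_ends_of_incident hze
      have key : ∀ X' Y' U I : Set V, U ⊆ X' ∪ Y' → I ⊆ X' ∩ Y' →
          G.probOn (L.erase e) (fun T => G.Linked T a b ∧ G.Separated a X' T) *
              G.probOn (L.erase e) (G.Separated a Y') ≤
            G.probOn (L.erase e) (G.Separated a U) *
              G.probOn (L.erase e) (fun T => G.Linked T a b ∧ G.Separated a I T) :=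
        fun X' Y' U I hU hI => (ih _ (Finset.erase_ssubset heL) X' Y').trans <|
          mul_le_mul (probOn_mono hp fun T _ h => h.subset hU)
            (probOn_mono hp fun T _ h => ⟨h.1, h.2.subset hI⟩)
            (probOn_nonneg hp _ _) (probOn_nonneg hp _ _)
      rw [← Finset.insert_erase heL]
      simp only [probOn_insert (Finset.notMem_erase e L),
        linked_and_separated_insert_iff he hz.1, linked_and_separated_insert_iff he hz,
        separated_insert_iff he hz.2, separated_insert_iff (X := X ∪ Y) he (Or.inl hz.1)]
      apply four_functions_two_points (hp e).1 (hp e).2 <;>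
        first | exact probOn_nonneg hp _ _ | (apply key <;> grind)
    · push Not at h
      by_cases ha : a ∈ X ∩ Y
      · rw [probOn_of_forall_not (Q := fun T => _ ∧ G.Separated a X T)
          fun T _ hT => hT.2 a ha.1 (.refl T a), zero_mul]
        exact mul_nonneg (probOn_nonneg hp _ _) (probOn_nonneg hp _ _)
      · have hsep : ∀ T ⊆ L, G.Separated a (X ∩ Y) T := fun T hT =>
          separated_of_isolated ha fun e he => h e (hT he)
        rw [probOn_congr (Q := fun T => _ ∧ G.Separated a (X ∩ Y) T)
          fun T hT => and_iff_left (hsep T hT)]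
        have h1 := probOn_and_le_mul hp (Q := fun T => G.Linked T a b)
          (fun S T hST hl => hl.mono hST) (separated_antitone (G := G) a X) L
        have h2 := probOn_mul_le_probOn_and hp (separated_antitone (G := G) a X)
          (separated_antitone (G := G) a Y) L
        simp only [← separated_union] at h2
        calc _ ≤ _ := mul_le_mul_of_nonneg_right h1 (probOn_nonneg hp _ _)
          _ = _ := mul_assoc _ _ _
          _ ≤ _ := mul_le_mul_of_nonneg_left h2 (probOn_nonneg hp _ _)
          _ = _ := mul_comm _ _

/-- Negative association of the clusters of `a` and of a set, conditioned on being disjoint. -/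
theorem probOn_linkedSet_separated_mul_le (hp : G.ProbValid) (a b : V) (L : Finset E)
    (X Y : Set V) :
    G.probOn L (fun T => G.LinkedSet X b T ∧ G.Separated a X T) * G.probOn L (G.Separated a Y) ≤
      G.probOn L (fun T => G.LinkedSet X b T ∧ G.Separated a (X ∪ Y) T) *
        G.probOn L (G.Separated a (X ∩ Y)) := by
  induction L using Finset.strongInduction generalizing X Y with
  | H L ih =>
    have key : ∀ e ∈ L, ∀ X' Y' X'' U I : Set V, X' ⊆ X'' → U ⊆ X' ∪ Y' → I ⊆ X' ∩ Y' →
        G.probOn (L.erase e) (fun T => G.LinkedSet X' b T ∧ G.Separated a X' T) *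
            G.probOn (L.erase e) (G.Separated a Y') ≤
          G.probOn (L.erase e) (fun T => G.LinkedSet X'' b T ∧ G.Separated a U T) *
            G.probOn (L.erase e) (G.Separated a I) :=
      fun e heL X' Y' X'' U I hX hU hI => (ih _ (Finset.erase_ssubset heL) X' Y').trans <|
        mul_le_mul (probOn_mono hp fun T _ h => ⟨h.1.subset hX, h.2.subset hU⟩)
          (probOn_mono hp fun T _ h => h.subset hI)
          (probOn_nonneg hp _ _) (probOn_nonneg hp _ _)
    by_cases ha : a ∈ X
    · rw [probOn_of_forall_not (Q := fun T => _ ∧ G.Separated a X T)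
        fun T _ hT => hT.2 a ha (.refl T a), zero_mul]
      exact mul_nonneg (probOn_nonneg hp _ _) (probOn_nonneg hp _ _)
    by_cases h : ∃ e ∈ L, ∃ z ∈ X ∩ Y, G.incident z e
    · obtain ⟨e, heL, z, hz, hze⟩ := h
      obtain ⟨v, he⟩ := exists_ends_of_incident hze
      rw [← Finset.insert_erase heL]
      simp only [probOn_insert (Finset.notMem_erase e L), linkedSet_insert_iff he hz.1,
        separated_insert_iff he hz.1, separated_insert_iff he hz,
        separated_insert_iff he hz.2, separated_insert_iff (X := X ∪ Y) he (Or.inl hz.1)]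
      apply four_functions_two_points (hp e).1 (hp e).2 <;>
        first | exact probOn_nonneg hp _ _ | (apply key e heL <;> grind)
    push Not at h
    have hsep : ∀ T ⊆ L, G.Separated a (X ∩ Y) T := fun T hT =>
      separated_of_isolated (fun h => ha h.1) fun e he => h e (hT he)
    rw [probOn_of_forall hsep, mul_one]
    by_cases h' : ∃ e ∈ L, ∃ z ∈ X, G.incident z e
    · obtain ⟨e, heL, z, hz, hze⟩ := h'
      obtain ⟨v, he⟩ := exists_ends_of_incident hze
      have hY : G.probOn L (G.Separated a Y) ≤ G.probOn (L.erase e) (G.Separated a Y) := by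
        nth_rewrite 1 [← Finset.insert_erase heL]
        rw [probOn_insert (Finset.notMem_erase e L)]
        have : G.probOn (L.erase e) (fun T => G.Separated a Y (insert e T)) ≤
            G.probOn (L.erase e) (G.Separated a Y) :=
          probOn_mono hp fun T _ h => separated_antitone a Y (Finset.subset_insert e T) h
        nlinarith [mul_le_mul_of_nonneg_left this (hp e).1]
      refine (mul_le_mul_of_nonneg_left hY (probOn_nonneg hp _ _)).trans ?_
      have key' : ∀ X' U : Set V, U ⊆ X' ∪ Y →
          G.probOn (L.erase e) (fun T => G.LinkedSet X' b T ∧ G.Separated a X' T) *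
            G.probOn (L.erase e) (G.Separated a Y) ≤
          G.probOn (L.erase e) (fun T => G.LinkedSet X' b T ∧ G.Separated a U T) :=
        fun X' U hU => (key e heL X' Y X' U _ subset_rfl hU subset_rfl).trans
          (mul_le_of_le_one_right (probOn_nonneg hp _ _) (probOn_le_one hp _ _))
      rw [← Finset.insert_erase heL]
      simp only [probOn_insert (Finset.notMem_erase e L), linkedSet_insert_iff he hz,
        separated_insert_iff he hz, separated_insert_iff (X := X ∪ Y) he (Or.inl hz)]
      rw [Finset.erase_insert (Finset.notMem_erase e L)]
      rw [add_mul, mul_assoc, mul_assoc]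
      exact add_le_add
        (mul_le_mul_of_nonneg_left (key' _ _ (by grind)) (hp e).1)
        (mul_le_mul_of_nonneg_left (key' _ _ (by grind)) (sub_nonneg.2 (hp e).2))
    · push Not at h'
      by_cases hb : b ∈ X
      · refine (mul_le_of_le_one_left (probOn_nonneg hp _ _) (probOn_le_one hp _ _)).trans ?_
        refine probOn_mono hp fun T hT h => ⟨⟨b, hb, .refl T b⟩, separated_union.2 ⟨?_, h⟩⟩
        exact separated_of_isolated ha fun e he => h' e (hT he)
      · rw [probOn_of_forall_not (Q := fun T => _ ∧ G.Separated a X T), zero_mul]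
        · exact probOn_nonneg hp _ _
        · rintro T hT ⟨⟨y, hy, hl⟩, -⟩
          have := hl.eq_of_isolated fun e he => h' e (hT he) y hy
          exact hb (this ▸ hy)

/-- If `a` is less likely than `s ∈ S` to be connected to `b`, then it is less likely than `S` to be
connected to `b` on the event that `a` is separated from `S`. -/
theorem probOn_linked_separated_le (hp : G.ProbValid) {a b s : V} {L : Finset E} {S : Set V}
    (hs : s ∈ S)
    (h : G.probOn L (fun T => G.Linked T a b) ≤ G.probOn L (fun T => G.Linked T s b)) :
    G.probOn L (fun T => G.Linked T a b ∧ G.Separated a S T) ≤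
      G.probOn L (fun T => G.LinkedSet S b T ∧ G.Separated a S T) := by
  have h1 := probOn_linked_separated_mul_le hp a b L S {s}
  have h2 := probOn_linkedSet_separated_mul_le hp a b L {s} S
  have e1 : S ∪ {s} = S := by grind
  have e2 : S ∩ {s} = {s} := by grind
  have e3 : {s} ∪ S = S := by grind
  have e4 : {s} ∩ S = {s} := by grind
  rw [e1, e2] at h1
  rw [e3, e4] at h2
  have hs' : G.probOn L (fun T => G.Linked T a b ∧ G.Separated a {s} T) ≤
      G.probOn L (fun T => G.LinkedSet {s} b T ∧ G.Separated a {s} T) := by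
    have ha := probOn_and_add_and_not (G := G) L (fun T => G.Linked T a b)
      (fun T => G.Linked T a s)
    have hb := probOn_and_add_and_not (G := G) L (fun T => G.Linked T s b)
      (fun T => G.Linked T a s)
    have hab : G.probOn L (fun T => G.Linked T a b ∧ G.Linked T a s) =
        G.probOn L (fun T => G.Linked T s b ∧ G.Linked T a s) :=
      probOn_congr fun T _ => and_congr_left fun h => ⟨h.symm.trans, h.trans⟩
    simp only [Separated, LinkedSet, Set.mem_singleton_iff, forall_eq, exists_eq_left]
    linarith
  have h3 : G.probOn L (fun T => G.LinkedSet {s} b T ∧ G.Separated a S T) ≤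
      G.probOn L (fun T => G.LinkedSet S b T ∧ G.Separated a S T) :=
    probOn_mono hp fun T _ h => ⟨h.1.subset (by simpa using hs), h.2⟩
  refine le_trans ?_ h3
  rcases (probOn_nonneg hp L (G.Separated a S)).eq_or_lt with h0 | h0
  · refine le_trans ?_ (probOn_nonneg hp _ _)
    rw [h0]
    exact probOn_mono hp fun T _ h => h.2
  · have h4 : 0 < G.probOn L (G.Separated a {s}) :=
      h0.trans_le (probOn_mono hp fun T _ h => h.subset (by simpa using hs))
    have h5 := mul_le_mul_of_nonneg_left hs' h0.le
    refine le_of_mul_le_mul_right ?_ h4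
    linarith

end LiveEdges

section Embedding

variable {E' : Type} {V E : Type}

/-- The edges of `L` with no endpoint in `W`. -/
def avoiding [DecidableEq V] (G : PercGraph V E) (L : Finset E) (W : Finset V) : Finset E :=
  L.filter fun e => (G.ends e).1 ∉ W ∧ (G.ends e).2 ∉ W

open Classical in
/-- The vertices connected to `x` through the edges of `T`. -/
noncomputable def linkedCluster [Fintype V] (G : PercGraph V E) (x : V) (T : Finset E) : Finset V :=
  Finset.univ.filter fun y => G.Linked T x y

/-- The worst connection probability to `b` from `A`, when only the edges of `L` are present. -/
noncomputable def minProbOn [DecidableEq E] (G : PercGraph V E) (A : Finset V) (hA : A.Nonempty)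
    (b : V) (L : Finset E) : ℝ :=
  A.inf' hA fun a => G.probOn L fun T => G.Linked T a b

/-- The correction term of the definition of good quadruples, for the set `T` of open edges. -/
noncomputable def goodCorrection [Fintype V] [DecidableEq V] [DecidableEq E] (G : PercGraph V E)
    (A : Finset V) (hA : A.Nonempty) (x b : V) (L T : Finset E) : ℝ :=
  if Disjoint (G.linkedCluster x T) A then
    G.minProbOn A hA b (G.avoiding L (G.linkedCluster x T)) else 0

/-- `f` identifies `G'` with a subgraph of `G`. -/
structure IsSubgraphEmbedding (G' : PercGraph V E') (G : PercGraph V E) (f : E' ↪ E) : Prop where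
  ends_apply : ∀ e, G.ends (f e) = G'.ends e
  p_apply : ∀ e, G.p (f e) = G'.p e

variable {G : PercGraph V E} {G' : PercGraph V E'} {f : E' ↪ E}

lemma minProbOn_nonneg [DecidableEq E] (hp : G.ProbValid) {A : Finset V} (hA : A.Nonempty) (b : V)
    (L : Finset E) : 0 ≤ G.minProbOn A hA b L :=
  Finset.le_inf' _ _ fun _ _ => probOn_nonneg hp _ _

lemma goodCorrection_nonneg [Fintype V] [DecidableEq V] [DecidableEq E] (hp : G.ProbValid)
    {A : Finset V} (hA : A.Nonempty) (x b : V) (L T : Finset E) :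
    0 ≤ G.goodCorrection A hA x b L T := by
  unfold goodCorrection
  split_ifs
  exacts [minProbOn_nonneg hp hA b _, le_rfl]

lemma IsSubgraphEmbedding.refl (G : PercGraph V E) :
    IsSubgraphEmbedding G G (Function.Embedding.refl E) :=
  ⟨fun _ => rfl, fun _ => rfl⟩

lemma IsSubgraphEmbedding.delete (h : IsSubgraphEmbedding G' G f) (W : Finset V) :
    IsSubgraphEmbedding (G'.delete W) G ((Function.Embedding.subtype _).trans f) :=
  ⟨fun e => h.ends_apply e.1, fun e => h.p_apply e.1⟩

variable [Fintype E']

lemma IsSubgraphEmbedding.conn_iff_linked (h : IsSubgraphEmbedding G' G f) {ω : E' → Bool}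
    {u v : V} :
    G'.Conn ω u v ↔ G.Linked ((Finset.univ.filter fun e => ω e).map f) u v := by
  have : G'.adj ω = fun u v => ∃ e ∈ (Finset.univ.filter fun e => ω e).map f,
      G.ends e = (u, v) ∨ G.ends e = (v, u) := by
    ext u v
    simp [adj, h.ends_apply]
  rw [Conn, Linked, this]

lemma IsSubgraphEmbedding.map_univ_delete [DecidableEq V] (h : IsSubgraphEmbedding G' G f)
    (W : Finset V) :
    Finset.univ.map ((Function.Embedding.subtype
        fun e => (G'.ends e).1 ∉ W ∧ (G'.ends e).2 ∉ W).trans f) =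
      G.avoiding (Finset.univ.map f) W := by
  ext e
  simp only [avoiding, Finset.mem_map, Finset.mem_univ, true_and, Finset.mem_filter]
  constructor
  · rintro ⟨⟨e', he'⟩, rfl⟩
    exact ⟨⟨e', rfl⟩, by simpa [h.ends_apply] using he'⟩
  · rintro ⟨⟨e', rfl⟩, he'⟩
    exact ⟨⟨e', by simpa [h.ends_apply] using he'⟩, rfl⟩

variable [DecidableEq E] [DecidableEq E']

lemma IsSubgraphEmbedding.sum_weight (h : IsSubgraphEmbedding G' G f) (φ : Finset E → ℝ) :
    ∑ ω : E' → Bool, φ ((Finset.univ.filter fun e => ω e).map f) * G'.weight ω =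
      G.expecOn (Finset.univ.map f) φ := by
  refine Finset.sum_nbij' (fun ω => (Finset.univ.filter fun e => ω e).map f)
    (fun T e => decide (f e ∈ T)) ?_ ?_ ?_ ?_ ?_
  · intro ω _
    exact Finset.mem_powerset.2 (Finset.map_subset_map.2 (Finset.filter_subset _ _))
  · simp
  · intro ω _
    ext e
    simp
  · intro T hT
    ext e
    simp only [decide_eq_true_eq, Finset.mem_map, Finset.mem_filter, Finset.mem_univ, true_and]
    constructor
    · rintro ⟨e', he', rfl⟩
      exact he'
    · intro he
      obtain ⟨e', -, rfl⟩ := Finset.mem_map.1 (Finset.mem_powerset.1 hT he)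
      exact ⟨e', he, rfl⟩
  · intro ω _
    rw [mul_comm]
    congr 1
    rw [weight, Finset.prod_ite, Finset.prod_map, ← Finset.map_sdiff, Finset.prod_map,
      ← Finset.filter_not]
    simp only [h.p_apply]

lemma IsSubgraphEmbedding.prob_eq (h : IsSubgraphEmbedding G' G f) {S : Set (E' → Bool)}
    {Q : Finset E → Prop} (hS : ∀ ω, ω ∈ S ↔ Q ((Finset.univ.filter fun e => ω e).map f)) :
    G'.prob S = G.probOn (Finset.univ.map f) Q := by
  classical
  rw [probOn, ← h.sum_weight, prob]
  refine Finset.sum_congr rfl fun ω _ => ?_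
  by_cases hω : ω ∈ S
  · rw [Set.indicator_of_mem hω, if_pos ((hS ω).1 hω), one_mul]
  · rw [Set.indicator_of_notMem hω, if_neg (mt (hS ω).2 hω), zero_mul]

lemma IsSubgraphEmbedding.prob_connEvent (h : IsSubgraphEmbedding G' G f) (a b : V) :
    G'.prob (G'.connEvent a b) = G.probOn (Finset.univ.map f) fun T => G.Linked T a b :=
  h.prob_eq fun _ => h.conn_iff_linked

lemma IsSubgraphEmbedding.prob_cluster [Fintype V] (h : IsSubgraphEmbedding G' G f) (x : V)
    (W : Finset V) :
    G'.prob {ω | G'.cluster ω {x} = ↑W} =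
      G.probOn (Finset.univ.map f) fun T => G.linkedCluster x T = W := by
  refine h.prob_eq fun ω => ?_
  rw [← Finset.coe_inj]
  simp [cluster, linkedCluster, h.conn_iff_linked]

variable [Fintype V] [DecidableEq V]

lemma IsSubgraphEmbedding.good_iff (h : IsSubgraphEmbedding G' G f) {A : Finset V}
    (hA : A.Nonempty) (x b : V) :
    G'.Good A hA x b ↔
      G.minProbOn A hA b (Finset.univ.map f) ≤
        G.probOn (Finset.univ.map f) (fun T => G.Linked T x b) +
          G.expecOn (Finset.univ.map f) (G.goodCorrection A hA x b (Finset.univ.map f)) := by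
  have hsum : ∑ W ∈ Finset.univ.filter (fun W : Finset V => W ∩ A = ∅),
        G'.prob {ω | G'.cluster ω {x} = ↑W} *
          A.inf' hA (fun a => (G'.delete W).prob ((G'.delete W).connEvent a b)) =
      G.expecOn (Finset.univ.map f) (G.goodCorrection A hA x b (Finset.univ.map f)) := by
    simp only [h.prob_cluster, (h.delete _).prob_connEvent, h.map_univ_delete]
    simp only [probOn, expecOn, Finset.sum_mul]
    rw [Finset.sum_comm]
    refine Finset.sum_congr rfl fun T _ => ?_
    simp only [mul_assoc]
    rw [← Finset.mul_sum, ← Finset.mul_sum]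
    congr 2
    simp [goodCorrection, minProbOn, probOn, expecOn, Finset.disjoint_iff_inter_eq_empty,
      Finset.sum_ite_eq]
  rw [Good, hsum, sub_le_iff_le_add]
  simp only [minProbOn, h.prob_connEvent]

end Embedding

section Antenna

variable {V E : Type} [DecidableEq V] {G : PercGraph V E} {x₀ : V} {T F : Finset E}

lemma ends_of_incident {e : E} (h : G.incident x₀ e) :
    G.ends e = (x₀, G.otherEnd x₀ e) ∨ G.ends e = (G.otherEnd x₀ e, x₀) := by
  unfold otherEnd
  split_ifs with h1
  · exact Or.inl (by rw [← h1])
  · exact Or.inr (by rw [← h.resolve_left h1])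

variable [DecidableEq E]

variable (hT : ∀ e ∈ T, ¬ G.incident x₀ e) (hF : ∀ e ∈ F, G.incident x₀ e)

include hT hF

lemma linked_union_center_iff {w : V} :
    G.Linked (T ∪ F) x₀ w ↔ w = x₀ ∨ ∃ e ∈ F, G.Linked T (G.otherEnd x₀ e) w := by
  constructor
  · intro h
    induction h with
    | refl => exact Or.inl rfl
    | @tail w w' _ hw ih =>
      obtain ⟨e, he, hends⟩ := hw
      rcases Finset.mem_union.1 he with he | he
      · rcases ih with rfl | ⟨e', he', hl⟩
        · refine absurd ?_ (hT e he)
          rcases hends with h | h <;> simp [incident, h]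
        · exact Or.inr ⟨e', he', hl.trans (.of_mem he hends)⟩
      · have h' := ends_of_incident (hF e he)
        by_cases hw' : w' = x₀
        · exact Or.inl hw'
        · refine Or.inr ⟨e, he, ?_⟩
          have : w' = G.otherEnd x₀ e := by
            rcases hends with h | h <;> rw [h] at h' <;> simp only [Prod.mk.injEq] at h' <;> grind
          rw [this]
          exact .refl _ _
  · rintro (rfl | ⟨e, he, hl⟩)
    · exact .refl _ _
    · exact .trans (.of_mem (Finset.mem_union_right T he) (ends_of_incident (hF e he)))
        (hl.mono Finset.subset_union_left)

lemma linked_union_imp {a w : V} (ha : a ≠ x₀) (h : G.Linked (T ∪ F) a w) :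
    (w ≠ x₀ ∧ G.Linked T a w) ∨ ((∃ e ∈ F, G.Linked T a (G.otherEnd x₀ e)) ∧
      (w = x₀ ∨ ∃ e ∈ F, G.Linked T (G.otherEnd x₀ e) w)) := by
  induction h with
  | refl => exact Or.inl ⟨ha, .refl _ _⟩
  | @tail w w' _ hw ih =>
    by_cases h0 : G.Linked (T ∪ F) x₀ w'
    · have h1 := (linked_union_center_iff hT hF).1 h0
      obtain ⟨e, he, hends⟩ := hw
      rcases ih with ⟨hwx, hl⟩ | ⟨hN, -⟩
      · rcases Finset.mem_union.1 he with he | he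
        · refine Or.inl ⟨?_, hl.trans (.of_mem he hends)⟩
          rintro rfl
          refine hT e he ?_
          rcases hends with h | h <;> simp [incident, h]
        · have h' := ends_of_incident (hF e he)
          have : w = G.otherEnd x₀ e := by
            rcases hends with h | h <;> rw [h] at h' <;> simp only [Prod.mk.injEq] at h' <;> grind
          exact Or.inr ⟨⟨e, he, this ▸ hl⟩, h1⟩
      · exact Or.inr ⟨hN, h1⟩
    · have hxw : ¬ G.Linked (T ∪ F) x₀ w := fun h => h0 (h.trans (.single hw))
      rw [linked_union_center_iff hT hF] at hxw
      rcases ih with ⟨hwx, hl⟩ | ⟨-, hN⟩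
      · obtain ⟨e, he, hends⟩ := hw
        rcases Finset.mem_union.1 he with he | he
        · exact Or.inl ⟨fun h => h0 (h ▸ .refl _ _), hl.trans (.of_mem he hends)⟩
        · refine absurd (Linked.trans ?_ (.single ⟨e, Finset.mem_union_right T he, hends⟩)) h0
          have h' := ends_of_incident (hF e he)
          have : w = G.otherEnd x₀ e ∨ w' = x₀ := by
            rcases hends with h | h <;> rw [h] at h' <;> simp only [Prod.mk.injEq] at h' <;> grind
          rcases this with rfl | rfl
          · exact .of_mem (Finset.mem_union_right T he) h'
          · exact absurd (.refl _ _) h0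
      · exact absurd hN hxw

end Antenna

/-- Domination of `P(a ↔ b)` given the set `F` of open edges at `x₀`, when `a` is least likely to be
connected to `b` without these edges. -/
lemma probOn_linked_union_le {V E : Type} [Fintype V] [DecidableEq V] [Fintype E] [DecidableEq E]
    {G : PercGraph V E} (hp : G.ProbValid) {A : Finset V} (hA : A.Nonempty) {x₀ b x a : V}
    (hx₀ : x₀ ∉ A) (hb : b ≠ x₀) {L F : Finset E}
    (hLx₀ : G.avoiding Finset.univ {x₀} = L)
    (hL : ∀ e ∈ L, ¬ G.incident x₀ e) (hF : ∀ e ∈ F, G.incident x₀ e)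
    (hiso : ∀ e ∈ F, G.otherEnd x₀ e ∈ A ∨ G.otherEnd x₀ e = x) (haA : a ∈ A)
    (ha : G.minProbOn A hA b L = G.probOn L fun T => G.Linked T a b)
    (hgood : G.minProbOn A hA b L ≤ G.probOn L (fun T => G.Linked T x b) +
      G.expecOn L (G.goodCorrection A hA x b L)) :
    G.probOn L (fun T => G.Linked (T ∪ F) a b) ≤
      G.probOn L (fun T => G.Linked (T ∪ F) x₀ b) +
        G.expecOn L (fun T => G.goodCorrection A hA x₀ b Finset.univ (T ∪ F)) := by
  have hT : ∀ T ⊆ L, ∀ e ∈ T, ¬ G.incident x₀ e := fun T hTL e he => hL e (hTL he)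
  have hax : a ≠ x₀ := fun h => hx₀ (h ▸ haA)
  have hcorr : 0 ≤ G.expecOn L (fun T => G.goodCorrection A hA x₀ b Finset.univ (T ∪ F)) :=
    expecOn_nonneg hp fun T _ => goodCorrection_nonneg hp hA _ _ _ _
  by_cases hs : ∃ e ∈ F, G.otherEnd x₀ e ∈ A
  · obtain ⟨e, heF, heA⟩ := hs
    set S : Set V := {v | ∃ e ∈ F, G.otherEnd x₀ e = v}
    have hmin : G.probOn L (fun T => G.Linked T a b) ≤
        G.probOn L (fun T => G.Linked T (G.otherEnd x₀ e) b) :=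
      ha ▸ Finset.inf'_le _ heA
    have h1 := probOn_linked_separated_le (S := S) hp ⟨e, heF, rfl⟩ hmin
    refine le_trans ?_ (le_add_of_nonneg_right hcorr)
    have h2 := probOn_and_add_and_not (G := G) L (fun T => G.Linked (T ∪ F) a b)
      (fun T => G.Separated a S T)
    have h3 := probOn_and_add_and_not (G := G) L (fun T => G.Linked (T ∪ F) x₀ b)
      (fun T => G.Separated a S T)
    have hSet : ∀ T ⊆ L, G.LinkedSet S b T → G.Linked (T ∪ F) x₀ b := by
      rintro T hTL ⟨_, ⟨e', he', rfl⟩, hl⟩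
      exact (linked_union_center_iff (hT T hTL) hF).2 (Or.inr ⟨e', he', hl⟩)
    have h4 : G.probOn L (fun T => G.Linked (T ∪ F) a b ∧ G.Separated a S T) ≤
        G.probOn L (fun T => G.Linked T a b ∧ G.Separated a S T) := by
      refine probOn_mono hp fun T hTL h => ⟨?_, h.2⟩
      rcases linked_union_imp (hT T hTL) hF hax h.1 with h' | ⟨⟨e', he', hl⟩, -⟩
      · exact h'.2
      · exact absurd hl (h.2 _ ⟨e', he', rfl⟩)
    have h5 : G.probOn L (fun T => G.LinkedSet S b T ∧ G.Separated a S T) ≤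
        G.probOn L (fun T => G.Linked (T ∪ F) x₀ b ∧ G.Separated a S T) :=
      probOn_mono hp fun T hTL h => ⟨hSet T hTL h.1, h.2⟩
    have h6 : G.probOn L (fun T => G.Linked (T ∪ F) a b ∧ ¬ G.Separated a S T) ≤
        G.probOn L (fun T => G.Linked (T ∪ F) x₀ b ∧ ¬ G.Separated a S T) := by
      refine probOn_mono hp fun T hTL h => ⟨?_, h.2⟩
      have h' := h.2
      simp only [Separated, not_forall, not_not] at h'
      obtain ⟨_, ⟨e', he', rfl⟩, hl⟩ := h'
      exact .trans ((linked_union_center_iff (hT T hTL) hF).2 (Or.inr ⟨e', he', .refl _ _⟩))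
        ((hl.symm.mono Finset.subset_union_left).trans h.1)
    linarith
  · push Not at hs
    have hFx : ∀ e ∈ F, G.otherEnd x₀ e = x := fun e he => (hiso e he).resolve_left (hs e he)
    have hab : G.probOn L (fun T => G.Linked (T ∪ F) a b) ≤ G.minProbOn A hA b L := by
      rw [ha]
      refine probOn_mono hp fun T hTL h => ?_
      rcases linked_union_imp (hT T hTL) hF hax h with h' | ⟨⟨e, he, hl⟩, h' | ⟨e', he', hl'⟩⟩
      · exact h'.2
      · exact absurd h' hb
      · rw [hFx e he] at hl
        rw [hFx e' he'] at hl'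
        exact hl.trans hl'
    refine hab.trans ?_
    rcases F.eq_empty_or_nonempty with rfl | ⟨e, he⟩
    · refine le_add_of_nonneg_of_le (probOn_nonneg hp _ _) ?_
      rw [← expecOn_const (G := G) L (G.minProbOn A hA b L)]
      refine expecOn_mono hp fun T hTL => ?_
      have : G.linkedCluster x₀ (T ∪ ∅) = {x₀} := by
        ext w
        simp [linkedCluster, -Finset.union_empty, linked_union_center_iff (hT T hTL) hF]
      simp [goodCorrection, this, hx₀, hLx₀, -Finset.union_empty]
    · have hcenter : ∀ T ⊆ L, ∀ w, G.Linked (T ∪ F) x₀ w ↔ w = x₀ ∨ G.Linked T x w := by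
        intro T hTL w
        rw [linked_union_center_iff (hT T hTL) hF]
        refine or_congr_right ⟨?_, fun h => ⟨e, he, (hFx e he).symm ▸ h⟩⟩
        rintro ⟨e', he', hl⟩
        exact hFx e' he' ▸ hl
      refine hgood.trans (add_le_add ?_ ?_)
      · exact probOn_mono hp fun T hTL h => (hcenter T hTL b).2 (Or.inr h)
      · refine expecOn_mono hp fun T hTL => le_of_eq ?_
        have hcl : G.linkedCluster x₀ (T ∪ F) = insert x₀ (G.linkedCluster x T) := by
          ext w
          simp [linkedCluster, hcenter T hTL]
        have hav : G.avoiding Finset.univ (insert x₀ (G.linkedCluster x T)) =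
            G.avoiding L (G.linkedCluster x T) := by
          rw [← hLx₀]
          ext e
          simp only [avoiding, Finset.mem_filter, Finset.mem_univ, true_and, Finset.mem_insert,
            Finset.mem_singleton]
          tauto
        simp only [goodCorrection, hcl, hav, Finset.disjoint_insert_left, hx₀, not_false_eq_true,
          true_and]

end PercGraph

open PercGraph

/-- if `0` is isolated in `G∖(A∪{x})`, `0` and `b` lie in disjoint
components of `G∖A`, and `(G∖{0}, A, x, b)` is good, then `(G, A, 0, b)` is good. -/
theorem good_of_antenna
    {V E : Type} [Fintype V] [DecidableEq V] [Fintype E] [DecidableEq E]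
    (G : PercGraph V E) (hp : G.ProbValid) (A : Finset V) (hA : A.Nonempty)
    (x₀ b x : V) (hx : x ∉ A)
    (hiso : ∀ e, G.incident x₀ e → G.otherEnd x₀ e ∈ A ∨ G.otherEnd x₀ e = x)
    (hdisj : ¬ (G.delete A).Conn (fun _ => true) x₀ b)
    (hdisj' : ¬ ((G.delete {x₀}).delete A).Conn (fun _ => true) x b)
    (hgood' : (G.delete {x₀}).Good A hA x b) :
    G.Good A hA x₀ b := by
  have hb : b ≠ x₀ := fun h => hdisj (h ▸ .refl)
  have hembed := IsSubgraphEmbedding.refl G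
  rw [hembed.good_iff, Finset.map_refl]
  rw [(hembed.delete {x₀}).good_iff, hembed.map_univ_delete, Finset.map_refl] at hgood'
  by_cases hx₀ : x₀ ∈ A
  · exact (Finset.inf'_le _ hx₀).trans
      (le_add_of_nonneg_right (expecOn_nonneg hp fun T _ => goodCorrection_nonneg hp hA _ _ _ _))
  obtain ⟨a, haA, ha⟩ :=
    A.exists_mem_eq_inf' hA fun a => G.probOn (G.avoiding Finset.univ {x₀}) fun T => G.Linked T a b
  refine (Finset.inf'_le _ haA).trans ?_
  have hL : ∀ e ∈ G.avoiding Finset.univ {x₀}, ¬ G.incident x₀ e := by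
    intro e he
    simpa [avoiding, incident] using he
  have hunion : Finset.univ =
      G.avoiding Finset.univ {x₀} ∪ (G.avoiding Finset.univ {x₀})ᶜ := by simp
  have hF : ∀ e ∈ (G.avoiding Finset.univ {x₀})ᶜ, G.incident x₀ e := by
    intro e he
    simp only [avoiding, Finset.mem_compl, Finset.mem_filter, Finset.mem_univ, true_and,
      Finset.mem_singleton] at he
    unfold incident
    tauto
  have hsplit := fun φ => (congrArg (fun M => G.expecOn M φ) hunion).trans
    (expecOn_union (Finset.disjoint_left.2 fun e he => by simpa using he) φ)
  rw [probOn, probOn, hsplit, hsplit, hsplit, ← expecOn_add]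
  refine expecOn_mono hp fun F hFL => ?_
  exact probOn_linked_union_le hp hA hx₀ hb rfl hL (fun e he => hF e (hFL he))
    (fun e he => hiso e (hF e (hFL he))) haA ha hgood'
end
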